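/- arXiv:2312.00056 — 5 statements merged into one kernel-verified Lean document; each statement's English description precedes it below -/
import Mathlib

section
/- Tutte's enumeration of rooted planar maps, in the permutation (rotation-system) encoding: for every integer n ≥ 1, let N_n be the number of pairs (σ, α) of permutations of {1, …, 2n} such that α is an involution without fixed points, the subgroup generated by σ and α acts transitively on {1, …, 2n}, and ℓ(σ) + ℓ(σ∘α) = n + 2, where ℓ(ρ) denotes the number of cycles of a permutation ρ (fixed points counted as cycles of length 1). Then (n + 2) · N_n = (2n−1)! · 2 · 3^n · Cat_n, where Cat_n = binom(2n, n)/(n + 1) is the n-th Catalan number; equivalently, the number m_n = N_n/(2n−1)! of rooted planar maps with n edges equals (2·3^n/(n+2)) · Cat_n. -/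
/-- The number of cycles `ℓ(ρ)` of a permutation, counting fixed points as cycles of
length `1`. -/
def cycleCount {n : ℕ} (ρ : Equiv.Perm (Fin n)) : ℕ :=
  ρ.cycleType.card + (Finset.univ.filter fun x => ρ x = x).card

section

open Equiv Polynomial

/-- The number of classes of an equivalence relation. -/
noncomputable def Setoid.classCount {D : Type*} (S : Setoid D) : ℕ := Nat.card (Quotient S)

/-- The smallest equivalence relation that contains `S` and identifies `x` with `y`. -/
def Setoid.join {D : Type*} (S : Setoid D) (x y : D) : Setoid D where
  r a b := S a b ∨ (S a x ∧ S y b) ∨ (S a y ∧ S x b)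
  iseqv :=
    { refl := fun a => Or.inl (S.refl' a)
      symm := by
        rintro a b (h | ⟨h, k⟩ | ⟨h, k⟩)
        · exact Or.inl (S.symm' h)
        · exact Or.inr (Or.inr ⟨S.symm' k, S.symm' h⟩)
        · exact Or.inr (Or.inl ⟨S.symm' k, S.symm' h⟩)
      trans := by
        have t : ∀ {a b c : D}, S a b → S b c → S a c := fun h k => S.trans' h k
        have s : ∀ {a b : D}, S a b → S b a := fun h => S.symm' h
        rintro a b c (h | ⟨h, k⟩ | ⟨h, k⟩) (h' | ⟨h', k'⟩ | ⟨h', k'⟩)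
        · exact Or.inl (t h h')
        · exact Or.inr (Or.inl ⟨t h h', k'⟩)
        · exact Or.inr (Or.inr ⟨t h h', k'⟩)
        · exact Or.inr (Or.inl ⟨h, t k h'⟩)
        · exact Or.inr (Or.inl ⟨h, k'⟩)
        · exact Or.inl (t h k')
        · exact Or.inr (Or.inr ⟨h, t k h'⟩)
        · exact Or.inl (t h k')
        · exact Or.inr (Or.inr ⟨h, k'⟩) }

namespace Setoid

variable {D : Type*}

theorem join_apply (S : Setoid D) (x y a b : D) :
    S.join x y a b ↔ S a b ∨ (S a x ∧ S y b) ∨ (S a y ∧ S x b) := Iff.rfl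

theorem le_join (S : Setoid D) (x y : D) : S ≤ S.join x y := fun _ _ h => Or.inl h

theorem join_rel (S : Setoid D) (x y : D) : S.join x y x y :=
  Or.inr (Or.inl ⟨S.refl' x, S.refl' y⟩)

theorem join_le_iff {S T : Setoid D} {x y : D} : S.join x y ≤ T ↔ S ≤ T ∧ T x y := by
  refine ⟨fun h => ⟨(S.le_join x y).trans h, h (S.join_rel x y)⟩, ?_⟩
  rintro ⟨h, hxy⟩ a b (k | ⟨k, l⟩ | ⟨k, l⟩)
  · exact h k
  · exact T.trans' (T.trans' (h k) hxy) (h l)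
  · exact T.trans' (T.trans' (h k) (T.symm' hxy)) (h l)

theorem join_eq_self {S : Setoid D} {x y : D} (h : S x y) : S.join x y = S :=
  le_antisymm (join_le_iff.2 ⟨le_rfl, h⟩) (S.le_join x y)

theorem join_sup (S T : Setoid D) (x y : D) : S.join x y ⊔ T = (S ⊔ T).join x y := by
  apply le_antisymm
  · refine sup_le (join_le_iff.2 ⟨le_sup_left.trans (le_join _ _ _), join_rel _ _ _⟩)
      (le_sup_right.trans (le_join _ _ _))
  · refine join_le_iff.2 ⟨sup_le_sup_right (le_join _ _ _) _, ?_⟩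
    exact (le_sup_left : S.join x y ≤ S.join x y ⊔ T) (join_rel _ _ _)

theorem sup_join (S T : Setoid D) (x y : D) : S ⊔ T.join x y = (S ⊔ T).join x y := by
  rw [sup_comm, join_sup, sup_comm]

theorem classCount_join_add_one [Finite D] {S : Setoid D} {x y : D} (h : ¬ S x y) :
    (S.join x y).classCount + 1 = S.classCount := by
  classical
  have := Fintype.ofFinite (Quotient S)
  have e : {q : Quotient S // q ≠ Quotient.mk S y} ≃ Quotient (S.join x y) := by
    refine Equiv.ofBijective
      (fun q => Quotient.map' (s₁ := S) (s₂ := S.join x y) id (fun a b k => Or.inl k) q.1) ⟨?_, ?_⟩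
    · rintro ⟨⟨a⟩, ha⟩ ⟨⟨b⟩, hb⟩ hab
      have ha' : ¬ S a y := fun k => ha (Quotient.sound k)
      have hb' : ¬ S b y := fun k => hb (Quotient.sound k)
      have hab' : S.join x y a b := Quotient.exact hab
      rcases hab' with k | ⟨_, k⟩ | ⟨k, _⟩
      · exact Subtype.ext (Quotient.sound k)
      · exact absurd (S.symm' k) hb'
      · exact absurd k ha'
    · rintro ⟨a⟩
      by_cases ha : S a y
      · refine ⟨⟨Quotient.mk S x, fun k => h (Quotient.exact k)⟩, ?_⟩
        exact Quotient.sound (s := S.join x y) (Or.inr (Or.inl ⟨S.refl' x, S.symm' ha⟩))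
      · exact ⟨⟨Quotient.mk S a, fun k => ha (Quotient.exact k)⟩, rfl⟩
  unfold classCount
  rw [← Nat.card_congr e, Nat.card_eq_fintype_card, Nat.card_eq_fintype_card,
    Fintype.card_subtype_compl, Fintype.card_subtype_eq]
  have : 0 < Fintype.card (Quotient S) := Fintype.card_pos_iff.2 ⟨Quotient.mk S y⟩
  omega

theorem classCount_le_join_add_one [Finite D] (S : Setoid D) (x y : D) :
    S.classCount ≤ (S.join x y).classCount + 1 := by
  by_cases h : S x y
  · rw [join_eq_self h]; omega
  · rw [classCount_join_add_one h]

theorem join_classCount_le [Finite D] (S : Setoid D) (x y : D) :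
    (S.join x y).classCount ≤ S.classCount := by
  by_cases h : S x y
  · rw [join_eq_self h]
  · rw [← classCount_join_add_one h]; omega

theorem classCount_congr {E : Type*} {S : Setoid D} {T : Setoid E} (e : D ≃ E)
    (h : ∀ a b, S a b ↔ T (e a) (e b)) : S.classCount = T.classCount :=
  Nat.card_congr (Quotient.congr e h)

end Setoid

namespace Equiv.Perm

variable {D : Type*}

/-- The partition of the ground set into the cycles of a permutation. -/
abbrev cyc (σ : Perm D) : Setoid D := SameCycle.setoid σ

/-- The number of cycles of a permutation, fixed points included. -/
noncomputable def numCycles (σ : Perm D) : ℕ := σ.cyc.classCount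

theorem cyc_apply {σ : Perm D} {x y : D} : σ.cyc x y ↔ σ.SameCycle x y := Iff.rfl

theorem cyc_rel (σ : Perm D) (x : D) : σ.cyc x (σ x) := ⟨1, by simp⟩

theorem cyc_le_iff {σ : Perm D} {T : Setoid D} : σ.cyc ≤ T ↔ ∀ x, T x (σ x) := by
  refine ⟨fun h x => h (cyc_rel σ x), ?_⟩
  rintro h x y ⟨i, rfl⟩
  induction i using Int.induction_on with
  | zero => exact T.refl' x
  | succ i ih =>
    rw [add_comm, zpow_add, zpow_one, mul_apply]
    exact T.trans' ih (h _)
  | pred i ih =>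
    refine T.trans' ih (T.symm' ?_)
    have := h ((σ ^ (-(i : ℤ) - 1)) x)
    rwa [← mul_apply, ← zpow_one_add, add_sub_cancel] at this

theorem numCycles_eq [Fintype D] [DecidableEq D] (σ : Perm D) :
    σ.numCycles = σ.cycleType.card + (Finset.univ.filter fun x => σ x = x).card := by
  classical
  let f : D → Perm D × Option D := fun x => (σ.cycleOf x, if σ x = x then some x else none)
  have hf : ∀ x y, f x = f y ↔ σ.SameCycle x y := by
    intro x y
    constructor
    · intro h
      simp only [f, Prod.mk.injEq] at h
      obtain ⟨h1, h2⟩ := h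
      by_cases hx : σ x = x
      · by_cases hy : σ y = y
        · simp only [hx, hy, if_true, Option.some.injEq] at h2
          rw [h2]
        · simp [hx, hy] at h2
      · by_cases hy : σ y = y
        · simp [hx, hy] at h2
        · exact (sameCycle_iff_cycleOf_eq_of_mem_support (mem_support.2 hx) (mem_support.2 hy)).2 h1
    · intro h
      by_cases hx : σ x = x
      · rw [h.eq_of_left hx]
      · have hy : σ y ≠ y := fun hy => hx (h.apply_eq_self_iff.2 hy)
        simp only [f, hx, hy, if_false, h.cycleOf_eq]
  have himg : Finset.univ.image f =
      (σ.cycleFactorsFinset ×ˢ {none}) ∪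
        ((Finset.univ.filter fun x => σ x = x).image fun x => ((1 : Perm D), some x)) := by
    ext ⟨c, o⟩
    simp only [Finset.mem_image, Finset.mem_univ, true_and, Finset.mem_union, Finset.mem_product,
      Finset.mem_singleton, Finset.mem_filter, f, Prod.mk.injEq]
    constructor
    · rintro ⟨x, rfl, rfl⟩
      by_cases hx : σ x = x
      · right
        exact ⟨x, hx, ((cycleOf_eq_one_iff σ).2 hx).symm, by simp [hx]⟩
      · left
        exact ⟨cycleOf_mem_cycleFactorsFinset_iff.2 (mem_support.2 hx), by simp [hx]⟩
    · rintro (⟨hc, rfl⟩ | ⟨x, hx, rfl, rfl⟩)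
      · obtain ⟨hc1, hc2⟩ := mem_cycleFactorsFinset_iff.1 hc
        obtain ⟨x, hx, -⟩ := id hc1
        have hxs : x ∈ c.support := mem_support.2 hx
        refine ⟨x, (cycle_is_cycleOf hxs hc).symm, ?_⟩
        rw [if_neg]
        rwa [← hc2 x hxs]
      · exact ⟨x, (cycleOf_eq_one_iff σ).2 hx, by simp [hx]⟩
  have hcard : σ.numCycles = (Finset.univ.image f).card := by
    have e : Quotient σ.cyc ≃ Set.range f :=
      (Quotient.congr (Equiv.refl D) (fun x y => (hf x y).symm)).trans
        (Setoid.quotientKerEquivRange f)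
    unfold numCycles Setoid.classCount
    rw [Nat.card_congr e, ← Set.ncard_coe_finset, Finset.coe_image, Finset.coe_univ,
      Set.image_univ]
    rfl
  rw [hcard, himg, Finset.card_union_of_disjoint, Finset.card_product,
    Finset.card_image_of_injective]
  · simp [cycleType_def]
  · intro x y h
    simpa using h
  · rw [Finset.disjoint_left]
    rintro ⟨c, o⟩ h1 h2
    simp only [Finset.mem_image, Finset.mem_product, Finset.mem_singleton, Prod.mk.injEq] at h1 h2
    obtain ⟨x, -, -, h⟩ := h2
    rw [h1.2] at h
    simp at h

theorem sign_eq_neg_one_pow_numCycles [Fintype D] [DecidableEq D] (σ : Perm D) :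
    sign σ = (-1) ^ (Fintype.card D + σ.numCycles) := by
  have h1 := sum_cycleType σ
  have h2 : (Finset.univ.filter fun x => σ x = x).card + σ.support.card = Fintype.card D := by
    have : σ.support = Finset.univ.filter fun x => ¬ σ x = x := by ext; simp
    rw [this, Finset.card_filter_add_card_filter_not, Finset.card_univ]
  rw [sign_of_cycleType, numCycles_eq, h1]
  have : Fintype.card D + (σ.cycleType.card + (Finset.univ.filter fun x => σ x = x).card)
      = (σ.support.card + σ.cycleType.card) + 2 * (Finset.univ.filter fun x => σ x = x).card := by
    omega
  rw [this, pow_add _ _ (2 * _), pow_mul]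
  simp

theorem numCycles_one [Finite D] : (1 : Perm D).numCycles = Nat.card D := by
  classical
  have := Fintype.ofFinite D
  rw [numCycles_eq]
  simp

theorem numCycles_le [Finite D] (σ : Perm D) : σ.numCycles ≤ Nat.card D :=
  Nat.card_le_card_of_surjective _ Quotient.mk_surjective

section swap

variable [DecidableEq D]

theorem join_cyc_mul_swap (σ : Perm D) (x y : D) :
    (σ * swap x y).cyc.join x y = σ.cyc.join x y := by
  have key : ∀ τ : Perm D, (τ * swap x y).cyc ≤ τ.cyc.join x y := by
    intro τ
    rw [cyc_le_iff]
    intro z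
    rw [mul_apply]
    by_cases hx : z = x
    · rw [hx, swap_apply_left]
      exact Or.inr (Or.inl ⟨Setoid.refl' _ _, cyc_rel τ y⟩)
    · by_cases hy : z = y
      · rw [hy, swap_apply_right]
        exact Or.inr (Or.inr ⟨Setoid.refl' _ _, cyc_rel τ x⟩)
      · rw [swap_apply_of_ne_of_ne hx hy]
        exact Or.inl (cyc_rel τ z)
  apply le_antisymm
  · exact Setoid.join_le_iff.2 ⟨key σ, Setoid.join_rel _ _ _⟩
  · refine Setoid.join_le_iff.2 ⟨?_, Setoid.join_rel _ _ _⟩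
    have := key (σ * swap x y)
    rwa [mul_assoc, swap_mul_self, mul_one] at this

theorem sameCycle_mul_swap [Finite D] (σ : Perm D) {x y : D} (hxy : x ≠ y) :
    (σ * swap x y).SameCycle x y ↔ ¬ σ.SameCycle x y := by
  have := Fintype.ofFinite D
  have hsign : sign (σ * swap x y) = - sign σ := by
    rw [sign_mul, sign_swap hxy, mul_neg, mul_one]
  rw [sign_eq_neg_one_pow_numCycles, sign_eq_neg_one_pow_numCycles] at hsign
  have hj := join_cyc_mul_swap σ x y
  have hpar : ((σ * swap x y).numCycles = σ.numCycles) → False := by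
    intro h
    rw [h] at hsign
    exact units_ne_neg_self _ hsign
  have hpar2 : ((σ * swap x y).numCycles + 1 = σ.numCycles) ∨
      ((σ * swap x y).numCycles = σ.numCycles + 1) ∨ ((σ * swap x y).numCycles = σ.numCycles) := by
    have h1 := Setoid.classCount_le_join_add_one (σ * swap x y).cyc x y
    have h2 := Setoid.join_classCount_le (σ * swap x y).cyc x y
    have h3 := Setoid.classCount_le_join_add_one σ.cyc x y
    have h4 := Setoid.join_classCount_le σ.cyc x y
    rw [hj] at h1 h2
    unfold numCycles
    omega
  constructor
  · intro h k
    rw [Setoid.join_eq_self (S := cyc _) h, Setoid.join_eq_self (S := cyc _) k] at hj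
    exact hpar (congrArg Setoid.classCount hj)
  · intro h
    by_contra k
    have h1 := Setoid.classCount_join_add_one (S := σ.cyc) h
    have h2 := Setoid.classCount_join_add_one (S := (σ * swap x y).cyc) k
    rw [hj] at h2
    exact hpar (h2.symm.trans h1)

theorem numCycles_mul_swap_of_sameCycle [Finite D] {σ : Perm D} {x y : D} (hxy : x ≠ y)
    (h : σ.SameCycle x y) : (σ * swap x y).numCycles = σ.numCycles + 1 := by
  have k : ¬ (σ * swap x y).SameCycle x y := fun k => (sameCycle_mul_swap σ hxy).1 k h
  have h2 := Setoid.classCount_join_add_one (S := (σ * swap x y).cyc) k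
  rw [join_cyc_mul_swap, Setoid.join_eq_self (S := σ.cyc) h] at h2
  exact h2.symm

theorem cyc_mul_swap_of_not_sameCycle [Finite D] {σ : Perm D} {x y : D}
    (h : ¬ σ.SameCycle x y) : (σ * swap x y).cyc = σ.cyc.join x y := by
  have hxy : x ≠ y := by rintro rfl; exact h (SameCycle.refl _ _)
  rw [← join_cyc_mul_swap, Setoid.join_eq_self]
  exact (sameCycle_mul_swap σ hxy).2 h

theorem numCycles_mul_swap_of_not_sameCycle [Finite D] {σ : Perm D} {x y : D}
    (h : ¬ σ.SameCycle x y) : (σ * swap x y).numCycles + 1 = σ.numCycles := by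
  unfold numCycles
  rw [cyc_mul_swap_of_not_sameCycle h]
  exact Setoid.classCount_join_add_one h

end swap

/-- The relation whose classes are the orbits of the group generated by two permutations. -/
def orbits (σ α : Perm D) : Setoid D := σ.cyc ⊔ α.cyc

theorem euler_le [Finite D] (σ α : Perm D) :
    σ.numCycles + α.numCycles + (σ * α).numCycles
      ≤ Nat.card D + 2 * (orbits σ α).classCount := by
  classical
  induction hk : Nat.card D - α.numCycles using Nat.strong_induction_on generalizing α with
  | _ k ih =>
    by_cases hα : α = 1
    · subst hα
      have : orbits σ 1 = σ.cyc := by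
        refine le_antisymm (sup_le le_rfl (cyc_le_iff.2 fun x => ?_)) le_sup_left
        exact Setoid.refl' _ x
      rw [this, numCycles_one, mul_one]
      change _ ≤ _ + 2 * σ.numCycles
      omega
    · obtain ⟨x, hx⟩ : ∃ x, α x ≠ x := by
        by_contra! h
        exact hα (Perm.ext h)
      set β := α * swap x (α x) with hβ
      have hβα : α = β * swap x (α x) := by rw [hβ, mul_assoc, swap_mul_self, mul_one]
      have hs : α.SameCycle x (α x) := cyc_rel α x
      have hn : β.numCycles = α.numCycles + 1 := numCycles_mul_swap_of_sameCycle hx.symm hs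
      have hle := numCycles_le β
      have hi := ih (Nat.card D - β.numCycles) (by omega) β rfl
      have hjoin : (orbits σ α).join x (α x) = (orbits σ β).join x (α x) := by
        unfold orbits
        rw [← Setoid.sup_join, ← Setoid.sup_join, hβ, join_cyc_mul_swap]
      have hO : orbits σ α x (α x) := (le_sup_right : α.cyc ≤ orbits σ α) (cyc_rel α x)
      rw [Setoid.join_eq_self hO] at hjoin
      have h1 := Setoid.classCount_le_join_add_one (orbits σ β) x (α x)
      rw [← hjoin] at h1
      have hprod : σ * α = σ * β * swap x (α x) := by rw [mul_assoc, ← hβα]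
      by_cases hsb : (σ * β).SameCycle x (α x)
      · have h2 := numCycles_mul_swap_of_sameCycle hx.symm hsb
        rw [← hprod] at h2
        have h3 : orbits σ β x (α x) := by
          have : (σ * β).cyc ≤ orbits σ β := cyc_le_iff.2 fun z => by
            refine Setoid.trans' _ ((le_sup_right : β.cyc ≤ orbits σ β) (cyc_rel β z)) ?_
            exact (le_sup_left : σ.cyc ≤ orbits σ β) (cyc_rel σ (β z))
          exact this hsb
        rw [hjoin, Setoid.join_eq_self h3]
        omega
      · have h2 := numCycles_mul_swap_of_not_sameCycle hsb
        rw [← hprod] at h2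
        omega

/-- The pair `(σ, α)` is a connected (hyper)map of genus zero. -/
def IsPlanarPair (σ α : Perm D) : Prop :=
  orbits σ α = ⊤ ∧ σ.numCycles + α.numCycles + (σ * α).numCycles = Nat.card D + 2

end Equiv.Perm

namespace Setoid

variable {D E : Type*}

/-- The disjoint union of two equivalence relations. -/
def disjointSum (S : Setoid D) (T : Setoid E) : Setoid (D ⊕ E) :=
  Setoid.ker (Sum.map (Quotient.mk S) (Quotient.mk T))

section

variable {S : Setoid D} {T : Setoid E}

@[simp] theorem disjointSum_inl_inl {a b : D} :
    S.disjointSum T (Sum.inl a) (Sum.inl b) ↔ S a b :=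
  Sum.inl_injective.eq_iff.trans Quotient.eq

@[simp] theorem disjointSum_inr_inr {a b : E} :
    S.disjointSum T (Sum.inr a) (Sum.inr b) ↔ T a b :=
  Sum.inr_injective.eq_iff.trans Quotient.eq

@[simp] theorem disjointSum_inl_inr {a : D} {b : E} :
    ¬ S.disjointSum T (Sum.inl a) (Sum.inr b) := Sum.inl_ne_inr

@[simp] theorem disjointSum_inr_inl {a : D} {b : E} :
    ¬ S.disjointSum T (Sum.inr b) (Sum.inl a) := Sum.inr_ne_inl

theorem disjointSum_le {U : Setoid (D ⊕ E)} (h1 : S ≤ U.comap Sum.inl)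
    (h2 : T ≤ U.comap Sum.inr) : S.disjointSum T ≤ U := by
  rintro (a | a) (b | b) h
  · exact h1 (disjointSum_inl_inl.1 h)
  · exact absurd h disjointSum_inl_inr
  · exact absurd h disjointSum_inr_inl
  · exact h2 (disjointSum_inr_inr.1 h)

end

theorem classCount_disjointSum [Finite D] [Finite E] (S : Setoid D) (T : Setoid E) :
    (S.disjointSum T).classCount = S.classCount + T.classCount := by
  unfold classCount
  rw [← Nat.card_sum]
  exact Nat.card_congr (Setoid.quotientKerEquivOfSurjective _
    (Sum.map_surjective.2 ⟨Quotient.mk_surjective, Quotient.mk_surjective⟩))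

theorem classCount_top [Nonempty D] : (⊤ : Setoid D).classCount = 1 := by
  have : Subsingleton (Quotient (⊤ : Setoid D)) :=
    ⟨by rintro ⟨a⟩ ⟨b⟩; exact Quotient.sound trivial⟩
  exact Nat.card_eq_one_iff_unique.2 ⟨this, ⟨Quotient.mk _ (Classical.arbitrary D)⟩⟩

theorem eq_top_iff_rel {S : Setoid D} : S = ⊤ ↔ ∀ x y, S x y :=
  Setoid.eq_top_iff

theorem disjointSum_join_eq_top_iff {S : Setoid D} {T : Setoid E} {a : D} {b : E} :
    (S.disjointSum T).join (Sum.inl a) (Sum.inr b) = ⊤ ↔ S = ⊤ ∧ T = ⊤ := by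
  simp only [eq_top_iff_rel, join_apply]
  constructor
  · intro h
    constructor
    · intro x y
      simpa using h (Sum.inl x) (Sum.inl y)
    · intro x y
      simpa using h (Sum.inr x) (Sum.inr y)
  · rintro ⟨h1, h2⟩ (x | x) (y | y) <;> simp [h1, h2]

end Setoid

namespace Equiv.Perm

variable {D E : Type*}

theorem orbits_le_iff {σ α : Perm D} {T : Setoid D} :
    orbits σ α ≤ T ↔ (∀ x, T x (σ x)) ∧ ∀ x, T x (α x) := by
  rw [orbits, sup_le_iff, cyc_le_iff, cyc_le_iff]

theorem orbits_rel_left (σ α : Perm D) (x : D) : orbits σ α x (σ x) :=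
  (orbits_le_iff.1 le_rfl).1 x

theorem orbits_rel_right (σ α : Perm D) (x : D) : orbits σ α x (α x) :=
  (orbits_le_iff.1 le_rfl).2 x

/-! ### Relabelling -/

theorem sameCycle_permCongr (e : D ≃ E) (σ : Perm D) (x y : D) :
    (e.permCongr σ).SameCycle (e x) (e y) ↔ σ.SameCycle x y := by
  have : ∀ i : ℤ, (e.permCongr σ) ^ i = e.permCongr (σ ^ i) := fun i =>
    (map_zpow e.permCongrHom σ i).symm
  simp [SameCycle, this]

theorem numCycles_permCongr (e : D ≃ E) (σ : Perm D) :
    (e.permCongr σ).numCycles = σ.numCycles :=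
  (Setoid.classCount_congr e fun a b => (sameCycle_permCongr e σ a b).symm).symm

theorem orbits_permCongr (e : D ≃ E) (σ α : Perm D) (x y : D) :
    orbits (e.permCongr σ) (e.permCongr α) (e x) (e y) ↔ orbits σ α x y := by
  constructor
  · have : orbits (e.permCongr σ) (e.permCongr α) ≤ (orbits σ α).comap e.symm := by
      rw [orbits_le_iff]
      constructor <;> intro z <;> rw [Setoid.comap_rel]
      · simpa using orbits_rel_left σ α (e.symm z)
      · simpa using orbits_rel_right σ α (e.symm z)
    intro h
    simpa [Setoid.comap_rel] using this h
  · have : orbits σ α ≤ (orbits (e.permCongr σ) (e.permCongr α)).comap e := by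
      rw [orbits_le_iff]
      constructor <;> intro z <;> rw [Setoid.comap_rel]
      · simpa using orbits_rel_left (e.permCongr σ) (e.permCongr α) (e z)
      · simpa using orbits_rel_right (e.permCongr σ) (e.permCongr α) (e z)
    intro h
    exact this h

theorem isPlanarPair_permCongr (e : D ≃ E) (σ α : Perm D) :
    IsPlanarPair (e.permCongr σ) (e.permCongr α) ↔ IsPlanarPair σ α := by
  have hmul : e.permCongr σ * e.permCongr α = e.permCongr (σ * α) :=
    (map_mul e.permCongrHom σ α).symm
  unfold IsPlanarPair
  rw [hmul, numCycles_permCongr, numCycles_permCongr, numCycles_permCongr, Nat.card_congr e,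
    Setoid.eq_top_iff_rel, Setoid.eq_top_iff_rel]
  refine and_congr_left fun _ => ⟨fun h x y => ?_, fun h x y => ?_⟩
  · exact (orbits_permCongr e σ α x y).1 (h _ _)
  · obtain ⟨x, rfl⟩ := e.surjective x
    obtain ⟨y, rfl⟩ := e.surjective y
    exact (orbits_permCongr e σ α x y).2 (h _ _)

/-! ### Disjoint unions -/

theorem cyc_sumCongr (σ : Perm D) (τ : Perm E) :
    cyc (sumCongr σ τ) = σ.cyc.disjointSum τ.cyc := by
  apply le_antisymm
  · rw [cyc_le_iff]
    rintro (x | x)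
    · exact Setoid.disjointSum_inl_inl.2 (cyc_rel σ x)
    · exact Setoid.disjointSum_inr_inr.2 (cyc_rel τ x)
  · apply Setoid.disjointSum_le <;> rw [cyc_le_iff] <;> intro x <;> rw [Setoid.comap_rel]
    · exact cyc_rel (sumCongr σ τ) (Sum.inl x)
    · exact cyc_rel (sumCongr σ τ) (Sum.inr x)

theorem orbits_sumCongr (σ α : Perm D) (τ β : Perm E) :
    orbits (sumCongr σ τ) (sumCongr α β) = (orbits σ α).disjointSum (orbits τ β) := by
  apply le_antisymm
  · rw [orbits_le_iff]
    constructor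
    · rintro (x | x)
      · exact Setoid.disjointSum_inl_inl.2 (orbits_rel_left σ α x)
      · exact Setoid.disjointSum_inr_inr.2 (orbits_rel_left τ β x)
    · rintro (x | x)
      · exact Setoid.disjointSum_inl_inl.2 (orbits_rel_right σ α x)
      · exact Setoid.disjointSum_inr_inr.2 (orbits_rel_right τ β x)
  · apply Setoid.disjointSum_le <;> rw [orbits_le_iff] <;> constructor <;> intro x <;>
      rw [Setoid.comap_rel]
    · exact orbits_rel_left (sumCongr σ τ) (sumCongr α β) (Sum.inl x)
    · exact orbits_rel_right (sumCongr σ τ) (sumCongr α β) (Sum.inl x)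
    · exact orbits_rel_left (sumCongr σ τ) (sumCongr α β) (Sum.inr x)
    · exact orbits_rel_right (sumCongr σ τ) (sumCongr α β) (Sum.inr x)

theorem numCycles_sumCongr [Finite D] [Finite E] (σ : Perm D) (τ : Perm E) :
    numCycles (sumCongr σ τ) = σ.numCycles + τ.numCycles := by
  unfold numCycles
  rw [cyc_sumCongr, Setoid.classCount_disjointSum]

theorem not_sameCycle_of_apply_eq {α : Perm D} {a b : D} (hab : a ≠ b) (ha : α a = a) :
    ¬ α.SameCycle a b := fun h => hab (h.eq_of_left ha)

section

variable [DecidableEq D] [DecidableEq E]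

theorem mul_swap_mul_mul_swap (ρ : Perm D) {α : Perm D} {a b : D} (ha : α a = a)
    (hb : α b = b) : ρ * swap a b * (α * swap a b) = ρ * α := by
  have h : α * swap a b = swap a b * α := by
    rw [mul_swap_eq_swap_mul, ha, hb]
  rw [h, mul_assoc, ← mul_assoc (swap a b), swap_mul_self, one_mul]

theorem isPlanarPair_mul_swap_iff_of_sameCycle [Finite D] {ρ α : Perm D} {a b : D} (hab : a ≠ b)
    (ha : α a = a) (hb : α b = b) (h : ρ.SameCycle a b) :
    IsPlanarPair (ρ * swap a b) (α * swap a b) ↔ IsPlanarPair ρ α := by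
  have h1 := numCycles_mul_swap_of_sameCycle hab h
  have h2 := numCycles_mul_swap_of_not_sameCycle (not_sameCycle_of_apply_eq hab ha)
  have h3 : orbits (ρ * swap a b) (α * swap a b) = orbits ρ α := by
    unfold orbits
    rw [cyc_mul_swap_of_not_sameCycle (not_sameCycle_of_apply_eq hab ha), Setoid.sup_join,
      ← Setoid.join_sup, join_cyc_mul_swap, Setoid.join_eq_self (S := cyc ρ) h]
  unfold IsPlanarPair
  rw [h3, mul_swap_mul_mul_swap ρ ha hb]
  refine and_congr_right fun _ => ?_
  omega

theorem orbits_mul_swap_of_not_sameCycle [Finite D] {ρ α : Perm D} {a b : D} (hab : a ≠ b)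
    (ha : α a = a) (h : ¬ ρ.SameCycle a b) :
    orbits (ρ * swap a b) (α * swap a b) = (orbits ρ α).join a b := by
  unfold orbits
  rw [cyc_mul_swap_of_not_sameCycle (not_sameCycle_of_apply_eq hab ha), Setoid.sup_join,
    cyc_mul_swap_of_not_sameCycle h, Setoid.join_sup]
  exact Setoid.join_eq_self (Setoid.join_rel _ _ _)

theorem isPlanarPair_sumCongr_mul_swap_iff [Finite D] [Finite E] {σ α : Perm D} {τ β : Perm E}
    {a : D} {b : E} (ha : α a = a) (hb : β b = b) :
    IsPlanarPair (sumCongr σ τ * swap (Sum.inl a) (Sum.inr b))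
        (sumCongr α β * swap (Sum.inl a) (Sum.inr b)) ↔
      IsPlanarPair σ α ∧ IsPlanarPair τ β := by
  have hn : ¬ SameCycle (sumCongr σ τ) (Sum.inl a) (Sum.inr b) := by
    rw [← cyc_apply, cyc_sumCongr]
    exact Setoid.disjointSum_inl_inr
  have hab : (Sum.inl a : D ⊕ E) ≠ Sum.inr b := Sum.inl_ne_inr
  have ha' : sumCongr α β (Sum.inl a) = Sum.inl a := by simp [ha]
  have hb' : sumCongr α β (Sum.inr b) = Sum.inr b := by simp [hb]
  have h1 := numCycles_mul_swap_of_not_sameCycle hn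
  have h2 := numCycles_mul_swap_of_not_sameCycle (not_sameCycle_of_apply_eq hab ha')
  unfold IsPlanarPair
  rw [orbits_mul_swap_of_not_sameCycle hab ha' hn, mul_swap_mul_mul_swap _ ha' hb',
    orbits_sumCongr, Setoid.disjointSum_join_eq_top_iff, sumCongr_mul, numCycles_sumCongr,
    Nat.card_sum]
  rw [numCycles_sumCongr] at h1 h2
  have e1 := euler_le σ α
  have e2 := euler_le τ β
  have : Nonempty D := ⟨a⟩
  have : Nonempty E := ⟨b⟩
  constructor
  · rintro ⟨⟨t1, t2⟩, h⟩
    rw [t1, Setoid.classCount_top] at e1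
    rw [t2, Setoid.classCount_top] at e2
    exact ⟨⟨t1, by omega⟩, t2, by omega⟩
  · rintro ⟨⟨t1, s1⟩, t2, s2⟩
    exact ⟨⟨t1, t2⟩, by omega⟩

theorem existsUnique_invariant_set [Finite D] {ρ α : Perm D} {a b : D} (hab : a ≠ b)
    (ha : α a = a) (hb : α b = b) (h : ¬ ρ.SameCycle a b)
    (hp : IsPlanarPair (ρ * swap a b) (α * swap a b)) :
    ∃! s : Set D, a ∈ s ∧ b ∉ s ∧ (∀ x, ρ x ∈ s ↔ x ∈ s) ∧ ∀ x, α x ∈ s ↔ x ∈ s := by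
  have h1 := numCycles_mul_swap_of_not_sameCycle h
  have h2 := numCycles_mul_swap_of_not_sameCycle (not_sameCycle_of_apply_eq hab ha)
  obtain ⟨t, hs⟩ := hp
  rw [orbits_mul_swap_of_not_sameCycle hab ha h] at t
  rw [mul_swap_mul_mul_swap _ ha hb] at hs
  have e := euler_le ρ α
  have hO : ¬ orbits ρ α a b := by
    intro k
    have : Nonempty D := ⟨a⟩
    rw [Setoid.join_eq_self k] at t
    rw [t, Setoid.classCount_top] at e
    omega
  refine ⟨{x | orbits ρ α a x}, ⟨Setoid.refl' (orbits ρ α) a, hO, fun x => ?_, fun x => ?_⟩, ?_⟩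
  · exact ⟨fun k => Setoid.trans' _ k (Setoid.symm' _ (orbits_rel_left ρ α x)),
      fun k => Setoid.trans' _ k (orbits_rel_left ρ α x)⟩
  · exact ⟨fun k => Setoid.trans' _ k (Setoid.symm' _ (orbits_rel_right ρ α x)),
      fun k => Setoid.trans' _ k (orbits_rel_right ρ α x)⟩
  · rintro s ⟨hsa, hsb, hsρ, hsα⟩
    have hle : orbits ρ α ≤ Setoid.ker (fun x => x ∈ s) := by
      rw [orbits_le_iff]
      exact ⟨fun x => propext (hsρ x).symm, fun x => propext (hsα x).symm⟩
    ext x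
    constructor
    · intro hx
      rcases Setoid.eq_top_iff_rel.1 t a x with k | ⟨_, k⟩ | ⟨k, _⟩
      · exact k
      · exact absurd ((hle k).mpr hx) hsb
      · exact absurd k hO
    · intro hx
      exact (hle hx).mp hsa

end

/-! ### Inserting a point into a cycle -/

theorem optionCongr_eq_permCongr_sumCongr (τ : Perm E) :
    optionCongr τ =
      (optionEquivSumPUnit.{0} E).symm.permCongr (sumCongr τ (1 : Perm PUnit.{1})) := by
  ext1 x
  cases x <;> simp [Equiv.permCongr_apply]

theorem cyc_optionCongr_some_some {τ : Perm E} {x y : E} :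
    cyc (optionCongr τ) (some x) (some y) ↔ τ.cyc x y := by
  have := sameCycle_permCongr (optionEquivSumPUnit.{0} E).symm (sumCongr τ (1 : Perm PUnit.{1}))
    (Sum.inl x) (Sum.inl y)
  rw [← optionCongr_eq_permCongr_sumCongr, ← cyc_apply, ← cyc_apply, cyc_sumCongr] at this
  simpa using this

theorem orbits_optionCongr_some_some {τ α : Perm E} {x y : E} :
    orbits (optionCongr τ) (optionCongr α) (some x) (some y) ↔ orbits τ α x y := by
  have := orbits_permCongr (optionEquivSumPUnit.{0} E).symm (sumCongr τ (1 : Perm PUnit.{1}))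
    (sumCongr α (1 : Perm PUnit.{1})) (Sum.inl x) (Sum.inl y)
  rw [← optionCongr_eq_permCongr_sumCongr, ← optionCongr_eq_permCongr_sumCongr,
    orbits_sumCongr] at this
  simpa using this

theorem not_orbits_optionCongr_none_some {τ α : Perm E} {x : E} :
    ¬ orbits (optionCongr τ) (optionCongr α) none (some x) := by
  have := orbits_permCongr (optionEquivSumPUnit.{0} E).symm (sumCongr τ (1 : Perm PUnit.{1}))
    (sumCongr α (1 : Perm PUnit.{1})) (Sum.inr PUnit.unit) (Sum.inl x)
  rw [← optionCongr_eq_permCongr_sumCongr, ← optionCongr_eq_permCongr_sumCongr,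
    orbits_sumCongr] at this
  simpa using this

theorem not_sameCycle_optionCongr_none_some {τ : Perm E} {x : E} :
    ¬ SameCycle (optionCongr τ) none (some x) := fun h =>
  not_orbits_optionCongr_none_some (α := τ) ((le_sup_left : cyc _ ≤ orbits _ _) h)

theorem numCycles_optionCongr [Finite E] (τ : Perm E) :
    numCycles (optionCongr τ) = τ.numCycles + 1 := by
  rw [optionCongr_eq_permCongr_sumCongr, numCycles_permCongr, numCycles_sumCongr, numCycles_one]
  simp

section

variable [DecidableEq E]

/-- Insert `none` into the cycle of `j`, right after `j`. -/
def insertNone (j : E) (τ : Perm E) : Perm (Option E) := optionCongr τ * swap none (some j)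

variable {j : E} {τ α : Perm E}

theorem insertNone_mul_optionCongr :
    insertNone j τ * optionCongr α = insertNone (α.symm j) (τ * α) := by
  have : swap none (some j) * optionCongr α = optionCongr α * swap none (some (α.symm j)) := by
    rw [mul_swap_eq_swap_mul]
    simp
  rw [insertNone, mul_assoc, this, ← mul_assoc, insertNone]
  congr 1
  ext1 x
  cases x <;> simp

variable [Finite E]

theorem cyc_insertNone :
    cyc (insertNone j τ) = (cyc (optionCongr τ)).join none (some j) :=
  cyc_mul_swap_of_not_sameCycle not_sameCycle_optionCongr_none_some

theorem sameCycle_insertNone_none_some {y : E} :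
    (insertNone j τ).SameCycle none (some y) ↔ τ.SameCycle j y := by
  rw [← cyc_apply, cyc_insertNone, Setoid.join_apply, cyc_optionCongr_some_some, cyc_apply]
  have h1 : ∀ y, ¬ cyc (optionCongr τ) none (some y) := fun y =>
    not_sameCycle_optionCongr_none_some
  have h2 : cyc (optionCongr τ) none none := Setoid.refl' _ _
  tauto

theorem numCycles_insertNone : (insertNone j τ).numCycles = τ.numCycles := by
  have := numCycles_mul_swap_of_not_sameCycle
    (not_sameCycle_optionCongr_none_some (τ := τ) (x := j))
  rw [numCycles_optionCongr] at this
  exact Nat.add_right_cancel this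

theorem isPlanarPair_insertNone :
    IsPlanarPair (insertNone j τ) (optionCongr α) ↔ IsPlanarPair τ α := by
  unfold IsPlanarPair
  have ho : orbits (insertNone j τ) (optionCongr α) =
      (orbits (optionCongr τ) (optionCongr α)).join none (some j) := by
    unfold orbits
    rw [cyc_insertNone, Setoid.join_sup]
  rw [insertNone_mul_optionCongr, numCycles_insertNone, numCycles_insertNone,
    numCycles_optionCongr, ho]
  have ht : (orbits (optionCongr τ) (optionCongr α)).join none (some j) = ⊤ ↔
      orbits τ α = ⊤ := by
    simp only [Setoid.eq_top_iff_rel, Setoid.join_apply]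
    have hn : ∀ y, ¬ orbits (optionCongr τ) (optionCongr α) (some y) none := fun y h =>
      not_orbits_optionCongr_none_some (Setoid.symm' _ h)
    constructor
    · intro h x y
      simpa [orbits_optionCongr_some_some, hn, not_orbits_optionCongr_none_some]
        using h (some x) (some y)
    · rintro h (_ | x) (_ | y) <;>
        simp [orbits_optionCongr_some_some, h, hn, not_orbits_optionCongr_none_some]
  rw [ht]
  refine and_congr_right fun _ => ?_
  rw [Finite.card_option]
  omega

end

theorem not_isPlanarPair_optionCongr [Nonempty E] (τ α : Perm E) :
    ¬ IsPlanarPair (optionCongr τ) (optionCongr α) := fun h =>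
  not_orbits_optionCongr_none_some (x := Classical.arbitrary E)
    (Setoid.eq_top_iff_rel.1 h.1 _ _)

end Equiv.Perm

namespace Equiv.Perm

variable {D E : Type*}

/-- The length of the cycle of a permutation through a given point. -/
noncomputable def cycleLength (σ : Perm D) (a : D) : ℕ := Nat.card {x // σ.SameCycle a x}

theorem cycleLength_permCongr (e : D ≃ E) (σ : Perm D) (a : D) :
    (e.permCongr σ).cycleLength (e a) = σ.cycleLength a :=
  (Nat.card_congr (e.subtypeEquiv fun x => (sameCycle_permCongr e σ a x).symm)).symm

theorem cycleLength_insertNone [DecidableEq E] [Finite E] (j : E) (τ : Perm E) :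
    (insertNone j τ).cycleLength none = τ.cycleLength j + 1 := by
  unfold cycleLength
  rw [← Finite.card_option]
  refine Nat.card_congr ⟨fun x => match x with
    | ⟨none, _⟩ => none
    | ⟨some y, h⟩ => some ⟨y, sameCycle_insertNone_none_some.1 h⟩, fun x => match x with
    | none => ⟨none, SameCycle.refl _ _⟩
    | some y => ⟨some y.1, sameCycle_insertNone_none_some.2 y.2⟩, ?_, ?_⟩
  · rintro ⟨_ | x, h⟩ <;> rfl
  · rintro (_ | x) <;> rfl

theorem cycleLength_mul_swap [DecidableEq D] [Finite D] {ρ : Perm D} {a b : D}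
    (h : ¬ ρ.SameCycle a b) :
    (ρ * swap a b).cycleLength a = ρ.cycleLength a + ρ.cycleLength b := by
  classical
  have := Fintype.ofFinite D
  have hab : a ≠ b := by rintro rfl; exact h (SameCycle.refl _ _)
  have hiff : ∀ x, (ρ * swap a b).SameCycle a x ↔ ρ.SameCycle a x ∨ ρ.SameCycle b x := by
    intro x
    rw [← cyc_apply, cyc_mul_swap_of_not_sameCycle h, Setoid.join_apply]
    simp only [cyc_apply]
    have := SameCycle.refl ρ a
    tauto
  unfold cycleLength
  simp only [hiff, Nat.card_eq_fintype_card]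
  rw [Fintype.card_subtype_or_disjoint]
  rw [Pi.disjoint_iff]
  intro x
  rw [Prop.disjoint_iff, not_and]
  exact fun h1 h2 => h (h1.trans h2.symm)

theorem cycleLength_sumCongr_inl (σ : Perm D) (τ : Perm E) (a : D) :
    cycleLength (sumCongr σ τ) (Sum.inl a) = σ.cycleLength a := by
  have hs : ∀ x y, SameCycle (sumCongr σ τ) x y ↔ σ.cyc.disjointSum τ.cyc x y := fun x y => by
    rw [← cyc_apply, cyc_sumCongr]
  refine (Nat.card_congr (Equiv.ofBijective
    (fun x => ⟨Sum.inl x.1, (hs _ _).2 (Setoid.disjointSum_inl_inl.2 x.2)⟩) ⟨?_, ?_⟩)).symm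
  · intro x y h
    simpa [Subtype.ext_iff] using h
  · rintro ⟨x | x, h⟩
    · exact ⟨⟨x, Setoid.disjointSum_inl_inl.1 ((hs _ _).1 h)⟩, rfl⟩
    · exact absurd ((hs _ _).1 h) Setoid.disjointSum_inl_inr

theorem cycleLength_sumCongr_inr (σ : Perm D) (τ : Perm E) (a : E) :
    cycleLength (sumCongr σ τ) (Sum.inr a) = τ.cycleLength a := by
  have hs : ∀ x y, SameCycle (sumCongr σ τ) x y ↔ σ.cyc.disjointSum τ.cyc x y := fun x y => by
    rw [← cyc_apply, cyc_sumCongr]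
  refine (Nat.card_congr (Equiv.ofBijective
    (fun x => ⟨Sum.inr x.1, (hs _ _).2 (Setoid.disjointSum_inr_inr.2 x.2)⟩) ⟨?_, ?_⟩)).symm
  · intro x y h
    simpa [Subtype.ext_iff] using h
  · rintro ⟨x | x, h⟩
    · exact absurd ((hs _ _).1 h) Setoid.disjointSum_inr_inl
    · exact ⟨⟨x, Setoid.disjointSum_inr_inr.1 ((hs _ _).1 h)⟩, rfl⟩

theorem minimalPeriod_eq_cycleLength [Finite E] (τ : Perm E) (a : E) :
    Function.minimalPeriod τ a = τ.cycleLength a := by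
  have hpos : 0 < Function.minimalPeriod τ a :=
    Function.minimalPeriod_pos_of_mem_periodicPts
      (τ.injective.mem_periodicPts a)
  rw [cycleLength, ← Nat.card_fin (Function.minimalPeriod τ a)]
  refine Nat.card_congr (Equiv.ofBijective
    (fun i : Fin _ => ⟨τ^[i] a, (i : ℤ), by simp [iterate_eq_pow]⟩) ⟨?_, ?_⟩)
  · intro i j h
    have := Function.iterate_injOn_Iio_minimalPeriod (f := τ) (x := a) i.2 j.2
      (Subtype.ext_iff.1 h)
    exact Fin.ext this
  · rintro ⟨x, h⟩
    obtain ⟨i, rfl⟩ := h.exists_nat_pow_eq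
    refine ⟨⟨i % Function.minimalPeriod τ a, Nat.mod_lt _ hpos⟩, Subtype.ext ?_⟩
    simp [Function.iterate_mod_minimalPeriod_eq, iterate_eq_pow]

section cycleSum

variable [DecidableEq E] [Finite E]

theorem insertNone_mul_swap_iterate (τ : Perm E) (a : E) {k : ℕ} (i : ℕ)
    (hi : k + i + 1 ≤ τ.cycleLength a) :
    (insertNone ((τ ^ k) a) τ * swap (some a) none)^[i + 1] (some a) =
      some (τ^[k + i + 1] a) := by
  rw [← minimalPeriod_eq_cycleLength] at hi
  induction i with
  | zero => simp [insertNone, Function.iterate_succ_apply', iterate_eq_pow]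
  | succ i ih =>
    rw [Function.iterate_succ_apply', ih (by lia)]
    have h1 : τ^[k + i + 1] a ≠ a := fun h => by
      have := Function.iterate_injOn_Iio_minimalPeriod (f := τ) (x := a)
        (show k + i + 1 < _ by lia) (show 0 < _ by lia) (by simpa using h)
      lia
    have h2 : τ^[k + i + 1] a ≠ τ^[k] a := fun h => by
      have := Function.iterate_injOn_Iio_minimalPeriod (f := τ) (x := a)
        (show k + i + 1 < _ by lia) (show k < _ by lia) h
      lia
    rw [← iterate_eq_pow, mul_apply, insertNone, mul_apply,
      swap_apply_of_ne_of_ne (fun h => h1 (Option.some_injective _ h)) (Option.some_ne_none _),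
      swap_apply_of_ne_of_ne (Option.some_ne_none _) (fun h => h2 (Option.some_injective _ h)),
      ← add_assoc,
      Function.iterate_succ_apply' _ (k + i + 1)]
    rfl

theorem cycleLength_insertNone_mul_swap (τ : Perm E) (a : E) {k : ℕ}
    (hk : k < τ.cycleLength a) :
    (insertNone ((τ ^ k) a) τ * swap (some a) none).cycleLength (some a) =
      τ.cycleLength a - k := by
  have hit := insertNone_mul_swap_iterate τ a (k := k)
  set σ := insertNone ((τ ^ k) a) τ * swap (some a) none with hσ
  have hper : σ^[τ.cycleLength a - k] (some a) = some a := by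
    have := hit (τ.cycleLength a - k - 1) (by lia)
    rw [show τ.cycleLength a - k - 1 + 1 = τ.cycleLength a - k by lia,
      show k + (τ.cycleLength a - k - 1) + 1 = τ.cycleLength a by lia] at this
    rw [this, ← minimalPeriod_eq_cycleLength, Function.iterate_minimalPeriod]
  have hle : Function.minimalPeriod σ (some a) ≤ τ.cycleLength a - k :=
    Function.IsPeriodicPt.minimalPeriod_le (by lia) hper
  have hpos : 0 < Function.minimalPeriod σ (some a) :=
    Function.minimalPeriod_pos_of_mem_periodicPts (σ.injective.mem_periodicPts _)
  rw [← minimalPeriod_eq_cycleLength]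
  refine le_antisymm hle ?_
  have h1 := hit (Function.minimalPeriod σ (some a) - 1) (by lia)
  rw [Nat.sub_add_cancel hpos, Function.iterate_minimalPeriod] at h1
  have h2 : Function.minimalPeriod τ a ≤ k + (Function.minimalPeriod σ (some a) - 1) + 1 :=
    Function.IsPeriodicPt.minimalPeriod_le (by lia) (Option.some_injective _ h1).symm
  rw [minimalPeriod_eq_cycleLength] at h2
  lia

end cycleSum

open Classical in
theorem sum_cycleLength_insertNone_mul_swap [DecidableEq E] [Fintype E] (τ : Perm E) (a : E) :
    (X - 1) * (∑ j, if τ.SameCycle a j then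
      (X : ℚ[X]) ^ (insertNone j τ * swap (some a) none).cycleLength (some a) else 0) =
    X * (X ^ τ.cycleLength a - 1) := by
  have hper := minimalPeriod_eq_cycleLength τ a
  have : (∑ j, if τ.SameCycle a j then
      (X : ℚ[X]) ^ (insertNone j τ * swap (some a) none).cycleLength (some a) else 0) =
      ∑ k ∈ Finset.range (τ.cycleLength a), X ^ (τ.cycleLength a - k) := by
    rw [← Finset.sum_filter]
    symm
    refine Finset.sum_bij (fun k _ => (τ ^ k) a) ?_ ?_ ?_ ?_
    · intro k _
      exact Finset.mem_filter.2 ⟨Finset.mem_univ _, (k : ℤ), by rw [zpow_natCast]⟩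
    · intro k hk l hl h
      rw [Finset.mem_range, ← hper] at hk hl
      exact Function.iterate_injOn_Iio_minimalPeriod (f := τ) (x := a) hk hl
        (by simpa [iterate_eq_pow] using h)
    · intro j hj
      obtain ⟨i, rfl⟩ := (Finset.mem_filter.1 hj).2.exists_nat_pow_eq
      refine ⟨i % τ.cycleLength a, Finset.mem_range.2 (Nat.mod_lt _ ?_), ?_⟩
      · rw [← hper]
        exact Function.minimalPeriod_pos_of_mem_periodicPts (τ.injective.mem_periodicPts a)
      · rw [← hper, ← iterate_eq_pow, ← iterate_eq_pow, Function.iterate_mod_minimalPeriod_eq]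
    · intro k hk
      rw [cycleLength_insertNone_mul_swap _ _ (Finset.mem_range.1 hk)]
  rw [this, ← Finset.sum_range_reflect, ← mul_geom_sum, mul_left_comm]
  congr 1
  rw [Finset.mul_sum]
  refine Finset.sum_congr rfl fun k hk => ?_
  rw [← pow_succ']
  congr 1
  have := Finset.mem_range.1 hk
  lia

end Equiv.Perm

/-- The indicator of a proposition, as a constant polynomial. -/
noncomputable def propIndicator (p : Prop) : ℚ[X] := open Classical in if p then 1 else 0

local notation "⟦" p "⟧ᵢ" => propIndicator p


section indicator

variable {p q : Prop}

theorem propIndicator_of (h : p) : ⟦p⟧ᵢ = 1 := if_pos h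

theorem propIndicator_of_not (h : ¬ p) : ⟦p⟧ᵢ = 0 := if_neg h

theorem propIndicator_and : ⟦p ∧ q⟧ᵢ = ⟦p⟧ᵢ * ⟦q⟧ᵢ := by
  by_cases hp : p <;> by_cases hq : q <;> simp [propIndicator, hp, hq]

theorem propIndicator_add_not (p : Prop) : ⟦p⟧ᵢ + ⟦¬ p⟧ᵢ = 1 := by
  by_cases hp : p <;> simp [propIndicator, hp]

theorem sum_propIndicator_of_existsUnique {ι : Type*} [Fintype ι] {P : ι → Prop}
    (h : ∃! i, P i) : ∑ i, ⟦P i⟧ᵢ = 1 := by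
  obtain ⟨i, hi, hu⟩ := h
  rw [Fintype.sum_eq_single i fun j hj => propIndicator_of_not fun h => hj (hu j h),
    propIndicator_of hi]

end indicator

namespace Equiv.Perm

variable {D E : Type*}

/-- `α` is an involution whose set of fixed points is `s`. -/
def IsInvolutionFixing (α : Perm D) (s : Set D) : Prop :=
  α * α = 1 ∧ ∀ x, α x = x ↔ x ∈ s

theorem isInvolutionFixing_permCongr (e : D ≃ E) {α : Perm D} {s : Set D} {t : Set E}
    (h : ∀ x, e x ∈ t ↔ x ∈ s) :
    IsInvolutionFixing (e.permCongr α) t ↔ IsInvolutionFixing α s := by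
  have hmul : e.permCongr α * e.permCongr α = e.permCongr (α * α) :=
    (map_mul e.permCongrHom α α).symm
  have h1 : e.permCongr (1 : Perm D) = 1 := map_one e.permCongrHom
  unfold IsInvolutionFixing
  rw [hmul]
  refine and_congr ⟨fun h => e.permCongr.injective (h.trans h1.symm), fun h => by rw [h, h1]⟩ ?_
  rw [← e.forall_congr_right]
  simp [h]

theorem isInvolutionFixing_optionCongr {α : Perm E} {s : Set E} {t : Set (Option E)}
    (h0 : none ∈ t) (h : ∀ x, some x ∈ t ↔ x ∈ s) :
    IsInvolutionFixing (optionCongr α) t ↔ IsInvolutionFixing α s := by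
  simp [IsInvolutionFixing, Equiv.ext_iff, Option.forall, h0, h]

theorem isInvolutionFixing_sumCongr {α : Perm D} {β : Perm E} {s : Set D} {t : Set E}
    {u : Set (D ⊕ E)} (hs : ∀ x, Sum.inl x ∈ u ↔ x ∈ s) (ht : ∀ x, Sum.inr x ∈ u ↔ x ∈ t) :
    IsInvolutionFixing (sumCongr α β) u ↔ IsInvolutionFixing α s ∧ IsInvolutionFixing β t := by
  simp only [IsInvolutionFixing, Equiv.ext_iff, Sum.forall, mul_apply, one_apply,
    sumCongr_apply, Sum.map_inl, Sum.map_inr, Sum.inl_injective.eq_iff, Sum.inr_injective.eq_iff,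
    hs, ht]
  tauto

theorem isInvolutionFixing_mul_swap [DecidableEq D] {β : Perm D} {a b : D} (hab : a ≠ b) :
    IsInvolutionFixing (β * swap a b) ∅ ∧ (β * swap a b) a = b ↔
      IsInvolutionFixing β {a, b} := by
  constructor
  · rintro ⟨⟨h1, h2⟩, h3⟩
    have hb : β b = b := by simpa using h3
    have ha : β a = a := by
      have := congrArg (fun f : Perm D => f a) h1
      simpa [hb] using this
    refine ⟨?_, fun x => ?_⟩
    · rw [← mul_swap_mul_mul_swap β ha hb, h1]
    · by_cases hxa : x = a
      · simp [hxa, ha]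
      by_cases hxb : x = b
      · simp [hxb, hb]
      have := h2 x
      rw [mul_apply, swap_apply_of_ne_of_ne hxa hxb] at this
      simpa [hxa, hxb] using this
  · rintro ⟨h1, h2⟩
    have ha : β a = a := (h2 a).2 (by simp)
    have hb : β b = b := (h2 b).2 (by simp)
    refine ⟨⟨by rw [mul_swap_mul_mul_swap β ha hb, h1], fun x => ?_⟩, by simp [hb]⟩
    by_cases hxa : x = a
    · simp [hxa, hb, hab.symm]
    by_cases hxb : x = b
    · simp [hxb, ha, hab]
    rw [mul_apply, swap_apply_of_ne_of_ne hxa hxb, h2]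
    simp [hxa, hxb]

section sums

variable (D) [Fintype D] [DecidableEq D]

/-- The generating polynomial, by degree of the root vertex, of planar maps on the half-edge set
`D` rooted at `r`. -/
noncomputable def rootSum (r : D) : ℚ[X] :=
  ∑ σ : Perm D, ∑ α : Perm D,
    ⟦IsInvolutionFixing α ∅ ∧ IsPlanarPair σ α⟧ᵢ * X ^ σ.cycleLength r

/-- The generating polynomial, by degree of the root vertex, of planar maps with one dangling
half-edge `r`, on the half-edge set `D`. -/
noncomputable def legSum (r : D) : ℚ[X] :=
  ∑ σ : Perm D, ∑ α : Perm D,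
    ⟦IsInvolutionFixing α {r} ∧ IsPlanarPair σ α⟧ᵢ * X ^ σ.cycleLength r

/-- The part of `rootSum` contributed by the maps in which `{a, b}` is an edge, written in terms
of the rotation system obtained by contracting that edge. -/
noncomputable def edgeSum (a b : D) : ℚ[X] :=
  ∑ ρ : Perm D, ∑ β : Perm D,
    ⟦IsInvolutionFixing β {a, b} ∧ IsPlanarPair (ρ * swap a b) (β * swap a b)⟧ᵢ *
      X ^ (ρ * swap a b).cycleLength a

/-- The part of `edgeSum` contributed by the maps in which the root edge is a loop. -/
noncomputable def loopSum (a b : D) : ℚ[X] :=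
  ∑ ρ : Perm D, ∑ β : Perm D,
    ⟦¬ ρ.SameCycle a b ∧ IsInvolutionFixing β {a, b} ∧
      IsPlanarPair (ρ * swap a b) (β * swap a b)⟧ᵢ * X ^ (ρ * swap a b).cycleLength a

/-- The part of `edgeSum` contributed by the maps in which the root edge is not a loop. -/
noncomputable def nonLoopSum (a b : D) : ℚ[X] :=
  ∑ ρ : Perm D, ∑ β : Perm D,
    ⟦ρ.SameCycle a b ∧ IsInvolutionFixing β {a, b} ∧ IsPlanarPair ρ β⟧ᵢ *
      X ^ (ρ * swap a b).cycleLength a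

variable {D}

variable [Fintype E] [DecidableEq E]

theorem legSum_equiv (e : D ≃ E) (r : D) : legSum D r = legSum E (e r) :=
  Fintype.sum_equiv e.permCongr _ _ fun σ => Fintype.sum_equiv e.permCongr _ _ fun α => by
    rw [isPlanarPair_permCongr, cycleLength_permCongr, isInvolutionFixing_permCongr e (s := {r})]
    simp

theorem edgeSum_equiv (e : D ≃ E) (a b : D) : edgeSum D a b = edgeSum E (e a) (e b) :=
  Fintype.sum_equiv e.permCongr _ _ fun ρ => Fintype.sum_equiv e.permCongr _ _ fun β => by
    have h : ∀ γ : Perm D, e.permCongr γ * swap (e a) (e b) = e.permCongr (γ * swap a b) := by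
      intro γ
      have : e.permCongr (swap a b) = swap (e a) (e b) := by
        rw [Equiv.permCongr_def, Equiv.symm_trans_swap_trans]
      rw [← this]
      exact (map_mul e.permCongrHom γ _).symm
    rw [h, h, isPlanarPair_permCongr, cycleLength_permCongr,
      isInvolutionFixing_permCongr e (s := {a, b})]
    simp

theorem rootSum_eq_sum_edgeSum (a : D) :
    rootSum D a = ∑ b ∈ Finset.univ.erase a, edgeSum D a b := by
  have h1 : ∀ σ α : Perm D,
      ⟦IsInvolutionFixing α ∅ ∧ IsPlanarPair σ α⟧ᵢ * (X : ℚ[X]) ^ σ.cycleLength a =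
      ∑ b ∈ Finset.univ.erase a, ⟦(IsInvolutionFixing α ∅ ∧ α a = b) ∧ IsPlanarPair σ α⟧ᵢ *
        X ^ σ.cycleLength a := by
    intro σ α
    by_cases h : IsInvolutionFixing α ∅
    · rw [Finset.sum_eq_single_of_mem (α a)]
      · simp [h]
      · simpa using (h.2 a).not.2 (by simp)
      · intro b _ hb
        rw [propIndicator_of_not (by tauto), zero_mul]
    · simp [propIndicator, h]
  simp only [rootSum, h1]
  simp only [Finset.sum_comm (s := Finset.univ) (t := Finset.univ.erase a)]
  refine Finset.sum_congr rfl fun b hb => ?_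
  have hab : a ≠ b := (Finset.ne_of_mem_erase hb).symm
  rw [edgeSum]
  symm
  refine Fintype.sum_equiv (Equiv.mulRight (swap a b)) _ _ fun ρ =>
    Fintype.sum_equiv (Equiv.mulRight (swap a b)) _ _ fun β => ?_
  simp only [coe_mulRight, isInvolutionFixing_mul_swap hab]

theorem edgeSum_eq_add {a b : D} (hab : a ≠ b) :
    edgeSum D a b = loopSum D a b + nonLoopSum D a b := by
  simp only [edgeSum, loopSum, nonLoopSum, ← Finset.sum_add_distrib, ← add_mul]
  refine Finset.sum_congr rfl fun ρ _ => Finset.sum_congr rfl fun β _ => ?_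
  congr 1
  have h : ⟦ρ.SameCycle a b ∧ IsInvolutionFixing β {a, b} ∧ IsPlanarPair ρ β⟧ᵢ =
      ⟦ρ.SameCycle a b ∧ IsInvolutionFixing β {a, b} ∧
        IsPlanarPair (ρ * swap a b) (β * swap a b)⟧ᵢ := by
    congr 1
    refine propext (and_congr_right fun h => and_congr_right fun h' => ?_)
    exact (isPlanarPair_mul_swap_iff_of_sameCycle hab ((h'.2 a).2 (by simp))
      ((h'.2 b).2 (by simp)) h).symm
  rw [h, propIndicator_and (p := ¬ _), propIndicator_and (p := ρ.SameCycle a b), ← add_mul,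
    add_comm ⟦¬ _⟧ᵢ, propIndicator_add_not, one_mul]

theorem sum_perm_option {M : Type*} [AddCommMonoid M] (g : Perm (Option E) → M) :
    ∑ σ, g σ = ∑ τ : Perm E, (g (optionCongr τ) + ∑ j, g (insertNone j τ)) := by
  calc ∑ σ, g σ = ∑ p : Option E × Perm E, g (optionCongr p.2 * swap none p.1) := by
        symm
        refine Fintype.sum_equiv (((Equiv.refl _).prodCongr (Equiv.inv _)).trans
          (decomposeOption.symm.trans (Equiv.inv _))) _ _ fun p => ?_
        congr 1
    _ = _ := by
        rw [Fintype.sum_prod_type_right]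
        refine Finset.sum_congr rfl fun τ _ => ?_
        rw [Fintype.sum_option]
        simp only [insertNone, swap_self]
        rfl

theorem sum_isInvolutionFixing_option {s : Set E} {t : Set (Option E)} (h0 : none ∈ t)
    (h : ∀ x, some x ∈ t ↔ x ∈ s) (g : Perm (Option E) → ℚ[X]) :
    ∑ α, ⟦IsInvolutionFixing α t⟧ᵢ * g α =
      ∑ α : Perm E, ⟦IsInvolutionFixing α s⟧ᵢ * g (optionCongr α) := by
  rw [sum_perm_option]
  refine Finset.sum_congr rfl fun α _ => ?_
  rw [isInvolutionFixing_optionCongr h0 h, Finset.sum_eq_zero, add_zero]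
  intro j _
  rw [propIndicator_of_not, zero_mul]
  intro hα
  have := (hα.2 none).2 h0
  simp [insertNone] at this

theorem legSum_option [Nonempty E] : legSum (Option E) none = X * ∑ a, rootSum E a := by
  simp only [legSum, propIndicator_and, mul_assoc]
  simp only [sum_isInvolutionFixing_option (s := (∅ : Set E)) (t := {none}) rfl (by simp)]
  rw [sum_perm_option]
  simp only [propIndicator_of_not (not_isPlanarPair_optionCongr _ _), zero_mul, mul_zero,
    Finset.sum_const_zero, zero_add, isPlanarPair_insertNone, cycleLength_insertNone]
  rw [Finset.sum_comm, Finset.mul_sum]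
  simp only [rootSum, Finset.mul_sum]
  refine Finset.sum_congr rfl fun j _ => Finset.sum_congr rfl fun σ _ =>
    Finset.sum_congr rfl fun α _ => ?_
  rw [propIndicator_and]
  ring

theorem legSum_of_unique [Unique D] (r : D) : legSum D r = X := by
  have hp : IsPlanarPair (1 : Perm D) 1 := by
    refine ⟨?_, by simp [numCycles_one]⟩
    rw [Setoid.eq_top_iff_rel]
    intro x y
    rw [Subsingleton.elim x y]
  have hi : IsInvolutionFixing (1 : Perm D) {r} :=
    ⟨one_mul 1, fun x => by simp [Subsingleton.elim x r]⟩
  have hc : cycleLength (1 : Perm D) r = 1 := by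
    rw [← minimalPeriod_eq_cycleLength]
    simp
  rw [legSum, Fintype.sum_unique, Fintype.sum_unique, Subsingleton.elim (default : Perm D) 1,
    propIndicator_of ⟨hi, hp⟩, hc]
  simp

theorem nonLoopSum_option (a : E) :
    (X - 1) * nonLoopSum (Option E) (some a) none =
      X * (legSum E a - C ((legSum E a).eval 1)) := by
  have hS : ∀ τ : Perm E, (X - 1) * ∑ j, ⟦τ.SameCycle a j⟧ᵢ *
      X ^ (insertNone j τ * swap (some a) none).cycleLength (some a) =
      X * (X ^ τ.cycleLength a - 1) := fun τ => by
    rw [← sum_cycleLength_insertNone_mul_swap]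
    congr 1
    refine Finset.sum_congr rfl fun j _ => ?_
    unfold propIndicator
    split_ifs <;> simp
  have h1 : ∀ τ : Perm E, ⟦SameCycle (optionCongr τ) (some a) none⟧ᵢ = 0 := fun τ =>
    propIndicator_of_not fun h => not_sameCycle_optionCongr_none_some h.symm
  have h2 : ∀ (j : E) (τ : Perm E),
      (insertNone j τ).SameCycle (some a) none ↔ τ.SameCycle a j := fun j τ => by
    rw [sameCycle_comm, sameCycle_insertNone_none_some, sameCycle_comm]
  have h3 : ∀ p, C ((⟦p⟧ᵢ).eval 1) = ⟦p⟧ᵢ := fun p => by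
    by_cases hp : p <;> simp [propIndicator, hp]
  have key : nonLoopSum (Option E) (some a) none = ∑ τ : Perm E, ∑ α : Perm E,
      ⟦IsInvolutionFixing α {a} ∧ IsPlanarPair τ α⟧ᵢ * ∑ j, ⟦τ.SameCycle a j⟧ᵢ *
      X ^ (insertNone j τ * swap (some a) none).cycleLength (some a) := by
    simp only [nonLoopSum, propIndicator_and, mul_assoc,
      mul_left_comm ⟦SameCycle _ _ _⟧ᵢ ⟦IsInvolutionFixing _ _⟧ᵢ]
    simp only [sum_isInvolutionFixing_option (s := ({a} : Set E)) (t := {some a, none})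
      (by simp) (by simp)]
    rw [sum_perm_option]
    simp only [h1, h2, isPlanarPair_insertNone, zero_mul, mul_zero, Finset.sum_const_zero,
      zero_add]
    refine Finset.sum_congr rfl fun τ _ => ?_
    rw [Finset.sum_comm]
    refine Finset.sum_congr rfl fun α _ => ?_
    rw [Finset.mul_sum, Finset.mul_sum]
    refine Finset.sum_congr rfl fun j _ => ?_
    ring
  rw [key, legSum]
  simp only [eval_finsetSum, eval_mul, eval_pow, eval_X, one_pow, mul_one, map_sum, h3,
    ← Finset.sum_sub_distrib]
  rw [Finset.mul_sum, Finset.mul_sum]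
  refine Finset.sum_congr rfl fun τ _ => ?_
  rw [Finset.mul_sum, Finset.mul_sum]
  refine Finset.sum_congr rfl fun α _ => ?_
  rw [mul_left_comm, hS]
  ring

end sums

end Equiv.Perm

namespace Equiv.Perm

variable {D : Type*} [Fintype D] [DecidableEq D]

theorem sum_perm_invariant (s : Finset D) (g : Perm D → ℚ[X]) :
    ∑ ρ : Perm D, ⟦∀ x, ρ x ∈ s ↔ x ∈ s⟧ᵢ * g ρ =
      ∑ ρ₁ : Perm {x // x ∈ s}, ∑ ρ₂ : Perm {x // ¬ x ∈ s},
        g ((sumCompl (· ∈ s)).permCongr (sumCongr ρ₁ ρ₂)) := by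
  rw [← Fintype.sum_prod_type']
  symm
  refine Fintype.sum_of_injective (fun p : Perm {x // x ∈ s} × Perm {x // ¬ x ∈ s} =>
    (sumCompl (· ∈ s)).permCongr (sumCongr p.1 p.2)) ?_ _ _ ?_ ?_
  · rintro ⟨p1, p2⟩ ⟨q1, q2⟩ h
    have := sumCongrHom_injective (a₁ := (p1, p2)) (a₂ := (q1, q2))
      ((sumCompl (· ∈ s)).permCongr.injective h)
    exact this
  · intro ρ hρ
    rw [propIndicator_of_not, zero_mul]
    intro h
    refine hρ ⟨(ρ.subtypePerm h, ρ.subtypePerm fun x => (h x).not), ?_⟩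
    ext x
    by_cases hx : x ∈ s <;> simp [hx, Equiv.permCongr_apply]
  · rintro ⟨p1, p2⟩
    rw [propIndicator_of, one_mul]
    intro x
    by_cases hx : x ∈ s
    · simp [hx, Equiv.permCongr_apply]
    · simpa [hx, Equiv.permCongr_apply] using (p2 ⟨x, hx⟩).2

theorem loopSum_eq {a b : D} (hab : a ≠ b) :
    loopSum D a b = ∑ s : {s : Finset D // a ∈ s ∧ b ∉ s},
      legSum {x // x ∈ s.1} ⟨a, s.2.1⟩ * legSum {x // ¬ x ∈ s.1} ⟨b, s.2.2⟩ := by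
  have h1 : ∀ ρ β : Perm D, ⟦¬ ρ.SameCycle a b ∧ IsInvolutionFixing β {a, b} ∧
      IsPlanarPair (ρ * swap a b) (β * swap a b)⟧ᵢ = 
      ∑ s : {s : Finset D // a ∈ s ∧ b ∉ s},
        ⟦∀ x, ρ x ∈ s.1 ↔ x ∈ s.1⟧ᵢ * (⟦∀ x, β x ∈ s.1 ↔ x ∈ s.1⟧ᵢ *
        ⟦¬ ρ.SameCycle a b ∧ IsInvolutionFixing β {a, b} ∧
          IsPlanarPair (ρ * swap a b) (β * swap a b)⟧ᵢ) := by
    intro ρ β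
    by_cases h : ¬ ρ.SameCycle a b ∧ IsInvolutionFixing β {a, b} ∧
      IsPlanarPair (ρ * swap a b) (β * swap a b)
    · simp only [propIndicator_of h, mul_one, ← propIndicator_and]
      symm
      apply sum_propIndicator_of_existsUnique
      obtain ⟨t, ⟨h1, h2, h3, h4⟩, h5⟩ := existsUnique_invariant_set hab
        ((h.2.1.2 a).2 (by simp)) ((h.2.1.2 b).2 (by simp)) h.1 h.2.2
      classical
      refine ⟨⟨t.toFinset, by simpa using ⟨h1, h2⟩⟩, by simpa using ⟨h3, h4⟩, ?_⟩
      rintro ⟨u, hu1, hu2⟩ ⟨hu3, hu4⟩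
      have := h5 u ⟨hu1, hu2, hu3, hu4⟩
      ext x
      simp [← this]
    · simp [propIndicator_of_not h]
  refine (Finset.sum_congr rfl fun ρ _ => Finset.sum_congr rfl fun β _ =>
    by rw [h1 ρ β, Finset.sum_mul]).trans ?_
  simp only [mul_assoc]
  simp only [Finset.sum_comm (s := (Finset.univ : Finset (Perm D)))
    (t := (Finset.univ : Finset {s : Finset D // a ∈ s ∧ b ∉ s}))]
  refine Finset.sum_congr rfl fun s _ => ?_
  obtain ⟨s, ha, hb⟩ := s
  simp only [← Finset.mul_sum, sum_perm_invariant]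
  simp only [legSum]
  rw [Finset.sum_mul_sum]
  refine Finset.sum_congr rfl fun ρ₁ _ => Finset.sum_congr rfl fun ρ₂ _ => ?_
  rw [Finset.sum_mul_sum]
  refine Finset.sum_congr rfl fun β₁ _ => Finset.sum_congr rfl fun β₂ _ => ?_
  set e := sumCompl (· ∈ s)
  have hswap : swap a b = e.permCongr (swap (Sum.inl ⟨a, ha⟩) (Sum.inr ⟨b, hb⟩)) := by
    rw [Equiv.permCongr_def, Equiv.symm_trans_swap_trans]
    rfl
  have hmul : ∀ γ, e.permCongr γ * swap a b =
      e.permCongr (γ * swap (Sum.inl ⟨a, ha⟩) (Sum.inr ⟨b, hb⟩)) := fun γ => by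
    rw [hswap]
    exact (map_mul e.permCongrHom γ _).symm
  have hns : ¬ SameCycle (sumCongr ρ₁ ρ₂) (Sum.inl ⟨a, ha⟩) (Sum.inr ⟨b, hb⟩) := by
    rw [← cyc_apply, cyc_sumCongr]
    exact Setoid.disjointSum_inl_inr
  have hs : ¬ SameCycle (e.permCongr (sumCongr ρ₁ ρ₂)) a b := 
    (sameCycle_permCongr e _ (Sum.inl ⟨a, ha⟩) (Sum.inr ⟨b, hb⟩)).not.2 hns
  have hl : cycleLength (e.permCongr (sumCongr ρ₁ ρ₂) * swap a b) a =
      ρ₁.cycleLength ⟨a, ha⟩ + ρ₂.cycleLength ⟨b, hb⟩ := by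
    rw [hmul]
    refine (cycleLength_permCongr e _ (Sum.inl ⟨a, ha⟩)).trans ?_
    rw [cycleLength_mul_swap hns, cycleLength_sumCongr_inl, cycleLength_sumCongr_inr]
  have hi : IsInvolutionFixing (e.permCongr (sumCongr β₁ β₂)) {a, b} ↔
      IsInvolutionFixing β₁ {⟨a, ha⟩} ∧ IsInvolutionFixing β₂ {⟨b, hb⟩} := by
    rw [isInvolutionFixing_permCongr e (s := {Sum.inl ⟨a, ha⟩, Sum.inr ⟨b, hb⟩}),
      isInvolutionFixing_sumCongr (s := {⟨a, ha⟩}) (t := {⟨b, hb⟩})]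
    · simp
    · simp
    · intro x
      simp only [Set.mem_insert_iff, Set.mem_singleton_iff]
      exact or_congr (e.injective.eq_iff (b := Sum.inl ⟨a, ha⟩))
        (e.injective.eq_iff (b := Sum.inr ⟨b, hb⟩))
  have hp : (¬ SameCycle (e.permCongr (sumCongr ρ₁ ρ₂)) a b ∧
      IsInvolutionFixing (e.permCongr (sumCongr β₁ β₂)) {a, b} ∧
      IsPlanarPair (e.permCongr (sumCongr ρ₁ ρ₂) * swap a b)
        (e.permCongr (sumCongr β₁ β₂) * swap a b)) ↔
      (IsInvolutionFixing β₁ {⟨a, ha⟩} ∧ IsPlanarPair ρ₁ β₁) ∧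
      IsInvolutionFixing β₂ {⟨b, hb⟩} ∧ IsPlanarPair ρ₂ β₂ := by
    rw [hi, hmul, hmul, isPlanarPair_permCongr]
    have : IsInvolutionFixing β₁ {⟨a, ha⟩} ∧ IsInvolutionFixing β₂ {⟨b, hb⟩} →
      (IsPlanarPair (sumCongr ρ₁ ρ₂ * swap (Sum.inl ⟨a, ha⟩) (Sum.inr ⟨b, hb⟩))
        (sumCongr β₁ β₂ * swap (Sum.inl ⟨a, ha⟩) (Sum.inr ⟨b, hb⟩)) ↔
      IsPlanarPair ρ₁ β₁ ∧ IsPlanarPair ρ₂ β₂) := fun h =>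
      isPlanarPair_sumCongr_mul_swap_iff ((h.1.2 _).2 rfl) ((h.2.2 _).2 rfl)
    tauto
  rw [hp, hl, propIndicator_and, pow_add]
  ring

/-- The generating polynomial `legSum` on a set with `m + 1` half-edges. -/
noncomputable def legPoly (m : ℕ) : ℚ[X] := legSum (Fin (m + 1)) 0

theorem exists_equiv_apply_eq {D E : Type*} [Fintype D] [Fintype E] [DecidableEq E]
    (h : Fintype.card D = Fintype.card E) (a : D) (b : E) : ∃ e : D ≃ E, e a = b := by
  let e := Fintype.equivOfCardEq h
  exact ⟨e.trans (swap (e a) b), by simp⟩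

theorem legSum_eq_legPoly {m : ℕ} (h : Fintype.card D = m + 1) (r : D) :
    legSum D r = legPoly m := by
  obtain ⟨e, he⟩ := exists_equiv_apply_eq (E := Fin (m + 1)) (by simpa using h) r 0
  rw [legSum_equiv e, he, legPoly]

theorem sum_separating_finsets {a b : D} (hab : a ≠ b) {m : ℕ} (h : Fintype.card D = m + 2)
    (f : ℕ → ℚ[X]) :
    ∑ s : {s : Finset D // a ∈ s ∧ b ∉ s}, f s.1.card =
      ∑ i ∈ Finset.range (m + 1), m.choose i • f (i + 1) := by
  have hc : ((Finset.univ.erase a).erase b).card = m := by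
    rw [Finset.card_erase_of_mem (by simpa using hab.symm),
      Finset.card_erase_of_mem (Finset.mem_univ a), Finset.card_univ, h]
    rfl
  have := Finset.sum_powerset_apply_card (fun i => f (i + 1))
    (x := (Finset.univ.erase a).erase b)
  rw [hc] at this
  rw [← this]
  refine Finset.sum_bij' (fun s _ => s.1.erase a) (fun t ht => ⟨insert a t, by simp, ?_⟩)
    ?_ ?_ ?_ ?_ ?_
  · have := Finset.mem_powerset.1 ht
    rw [Finset.mem_insert, not_or]
    exact ⟨hab.symm, fun hb => by simpa using this hb⟩
  · rintro ⟨s, ha, hb⟩ _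
    rw [Finset.mem_powerset]
    intro x hx
    have hx' := Finset.mem_erase.1 hx
    simp only [Finset.mem_erase, Finset.mem_univ, and_true]
    exact ⟨by rintro rfl; exact hb hx'.2, hx'.1⟩
  · simp
  · rintro ⟨s, ha, hb⟩ _
    simp [Finset.insert_erase ha]
  · intro t ht
    have := Finset.mem_powerset.1 ht
    exact Finset.erase_insert fun ha => by simpa using this ha
  · rintro ⟨s, ha, hb⟩ _
    simp only
    rw [Finset.card_erase_add_one ha]

theorem loopSum_eq_sum_legPoly {a b : D} (hab : a ≠ b) {m : ℕ} (h : Fintype.card D = m + 2) :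
    loopSum D a b =
      ∑ i ∈ Finset.range (m + 1), m.choose i • (legPoly i * legPoly (m - i)) := by
  rw [loopSum_eq hab]
  refine Eq.trans ?_ (sum_separating_finsets hab h
    fun i => legPoly (i - 1) * legPoly (m - (i - 1)))
  refine Finset.sum_congr rfl fun s _ => ?_
  obtain ⟨s, ha, hb⟩ := s
  have h1 : 0 < s.card := Finset.card_pos.2 ⟨a, ha⟩
  have h2 : s.card + Fintype.card {x // ¬ x ∈ s} = m + 2 := by
    rw [← h, Fintype.card_subtype_compl, Fintype.card_coe]
    have := Finset.card_le_univ s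
    lia
  have h3 : 0 < Fintype.card {x // ¬ x ∈ s} := Fintype.card_pos_iff.2 ⟨⟨b, hb⟩⟩
  simp only
  rw [legSum_eq_legPoly (m := s.card - 1) (by rw [Fintype.card_coe]; lia),
    legSum_eq_legPoly (m := m - (s.card - 1)) (by lia)]

theorem legPoly_of_odd {m : ℕ} (hm : Odd m) : legPoly m = 0 := by
  unfold legPoly legSum
  refine Finset.sum_eq_zero fun σ _ => Finset.sum_eq_zero fun α _ => ?_
  rw [propIndicator_of_not, zero_mul]
  rintro ⟨⟨h1, h2⟩, -⟩
  have h3 : α.support = {0}ᶜ := by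
    ext x
    simpa using (h2 x).not
  have h4 : 2 ∣ α.support.card := two_dvd_card_support (by rw [pow_two, h1])
  rw [h3, Finset.card_compl] at h4
  simp at h4
  exact (Nat.not_even_iff_odd.2 hm) (even_iff_two_dvd.2 h4)

end Equiv.Perm

theorem Finset.sum_range_two_mul_add_one_of_odd {M : Type*} [AddCommMonoid M] {f : ℕ → M}
    (hf : ∀ i, Odd i → f i = 0) (n : ℕ) :
    ∑ i ∈ Finset.range (2 * n + 1), f i = ∑ k ∈ Finset.range (n + 1), f (2 * k) := by
  induction n with
  | zero => simp
  | succ n ih =>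
    rw [Finset.sum_range_succ _ (n + 1), ← ih, mul_add, Finset.sum_range_succ,
      Finset.sum_range_succ, hf (2 * n + 1) (odd_two_mul_add_one n), add_zero]

/-- The recursion obtained by contracting the root edge of a rooted planar map, where `F n` counts
the rooted planar maps with `n` edges by the degree of the root vertex. -/
structure IsTutteSequence (F : ℕ → ℚ[X]) : Prop where
  zero : F 0 = 1
  succ : ∀ n, (X - 1) * F (n + 1) =
    (X - 1) * X ^ 2 * ∑ k ∈ Finset.range (n + 1), F k * F (n - k) +
      X * (X * F n - C ((F n).eval 1))

namespace Equiv.Perm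

theorem exists_equiv_apply_eq_apply_eq {D E : Type*} [Fintype D] [Fintype E] [DecidableEq E]
    (h : Fintype.card D = Fintype.card E) {a b : D} {c d : E} (hab : a ≠ b) (hcd : c ≠ d) :
    ∃ e : D ≃ E, e a = c ∧ e b = d := by
  obtain ⟨e, rfl⟩ := exists_equiv_apply_eq h a c
  exact ⟨e.trans (swap (e b) d), by
    simpa using swap_apply_of_ne_of_ne (e.injective.ne hab) hcd, by simp⟩

section

variable {F : ℕ → ℚ[X]} {n : ℕ}

theorem edgeSum_of_legPoly
    (hF : IsTutteSequence F) (h : ∀ k ≤ n, legPoly (2 * k) = ((2 * k).factorial : ℚ[X]) * (X * F k))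
    {D : Type*} [Fintype D] [DecidableEq D] (hD : Fintype.card D = 2 * n + 2) {a b : D}
    (hab : a ≠ b) : edgeSum D a b = ((2 * n).factorial : ℚ[X]) * F (n + 1) := by
  obtain ⟨e, he1, he2⟩ := exists_equiv_apply_eq_apply_eq (E := Option (Fin (2 * n + 1)))
    (by simpa using hD) hab (Option.some_ne_none 0)
  rw [edgeSum_equiv e, he1, he2, edgeSum_eq_add (Option.some_ne_none _),
    loopSum_eq_sum_legPoly (m := 2 * n) (Option.some_ne_none _) (by simp)]
  rw [Finset.sum_range_two_mul_add_one_of_odd fun i hi => by simp [legPoly_of_odd hi]]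
  have hi : ∑ k ∈ Finset.range (n + 1),
      (2 * n).choose (2 * k) • (legPoly (2 * k) * legPoly (2 * n - 2 * k)) =
      ((2 * n).factorial : ℚ[X]) * (X ^ 2 * ∑ k ∈ Finset.range (n + 1), F k * F (n - k)) := by
    rw [Finset.mul_sum, Finset.mul_sum]
    refine Finset.sum_congr rfl fun k hk => ?_
    have hk : k ≤ n := Nat.lt_succ_iff.1 (Finset.mem_range.1 hk)
    rw [← Nat.mul_sub, h k hk, h (n - k) (Nat.sub_le _ _),
      ← Nat.choose_mul_factorial_mul_factorial (Nat.mul_le_mul_left 2 hk), ← Nat.mul_sub,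
      nsmul_eq_mul]
    push_cast
    ring
  have hX : (X - 1 : ℚ[X]) ≠ 0 := by simpa using X_sub_C_ne_zero (1 : ℚ)
  have hleg : legSum (Fin (2 * n + 1)) 0 = ((2 * n).factorial : ℚ[X]) * (X * F n) :=
    h n le_rfl
  refine mul_left_cancel₀ hX ?_
  rw [hi, mul_add, nonLoopSum_option, hleg, mul_left_comm, ← mul_assoc (X - 1),
    mul_left_comm (X - 1) _ (F (n + 1)), hF.succ]
  simp only [eval_mul, eval_X, one_mul, eval_natCast, C_mul, map_natCast]
  ring

theorem rootSum_of_legPoly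
    (hF : IsTutteSequence F) (h : ∀ k ≤ n, legPoly (2 * k) = ((2 * k).factorial : ℚ[X]) * (X * F k))
    {D : Type*} [Fintype D] [DecidableEq D] (hD : Fintype.card D = 2 * n + 2) (a : D) :
    rootSum D a = ((2 * n + 1).factorial : ℚ[X]) * F (n + 1) := by
  rw [rootSum_eq_sum_edgeSum, Finset.sum_congr rfl fun b hb =>
    edgeSum_of_legPoly hF h hD (Finset.ne_of_mem_erase hb).symm, Finset.sum_const,
    Finset.card_erase_of_mem (Finset.mem_univ a), Finset.card_univ, hD, nsmul_eq_mul,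
    Nat.factorial_succ]
  push_cast
  ring

theorem legPoly_two_mul (hF : IsTutteSequence F) (n : ℕ) :
    legPoly (2 * n) = ((2 * n).factorial : ℚ[X]) * (X * F n) := by
  induction n using Nat.strong_induction_on with
  | _ n ih =>
  cases n with
  | zero => simpa [legPoly, hF.zero] using legSum_of_unique (D := Fin 1) 0
  | succ n =>
    rw [← legSum_eq_legPoly (D := Option (Fin (2 * n + 2))) (by simp; lia) none, legSum_option,
      Finset.sum_congr rfl fun a _ => rootSum_of_legPoly hF
        (fun k hk => ih k (Nat.lt_succ_of_le hk)) (by simp) a, Finset.sum_const,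
      Finset.card_univ, Fintype.card_fin, nsmul_eq_mul, mul_add, mul_one,
      Nat.factorial_succ (2 * n + 1)]
    push_cast
    ring

theorem rootSum_eq (hF : IsTutteSequence F) {D : Type*} [Fintype D] [DecidableEq D]
    (hD : Fintype.card D = 2 * n + 2) (a : D) :
    rootSum D a = ((2 * n + 1).factorial : ℚ[X]) * F (n + 1) :=
  rootSum_of_legPoly hF (fun k _ => legPoly_two_mul hF k) hD a

end

end Equiv.Perm

section algebra

theorem tutte_identity {R : Type*} [CommRing R] [IsDomain R] {A y t u d Q F f : R}
    (hA : A = 1 + 9 * y * A ^ 2) (hQ : Q = 1 + 3 * y * A * t + y * (A + 2) * t ^ 2)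
    (hu : u * Q = t) (hd : d = 1 - 3 * y * A * t) (hF : F * d = (1 - A * (y * (A + 2)) * t) * Q)
    (hf : 3 * f = A * (4 - A)) (hQ0 : Q ≠ 0) (hd0 : d ≠ 0) :
    (u - 1) * F = (u - 1) + 3 * y * (u ^ 2 * (u - 1) * F ^ 2 + u * (u * F - f)) := by
  have h1 : u * F * d = (1 - A * (y * (A + 2)) * t) * t := by
    linear_combination u * hF + (1 - A * (y * (A + 2)) * t) * hu
  have e1 : Q * d ^ 2 * ((u - 1) * F) =
      (t - Q) * d * ((1 - A * (y * (A + 2)) * t) * Q) := by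
    linear_combination ((u - 1) * Q * d) * hF +
      d * ((1 - A * (y * (A + 2)) * t) * Q) * hu
  have e2 : Q * d ^ 2 * (u ^ 2 * (u - 1) * F ^ 2) =
      (t - Q) * ((1 - A * (y * (A + 2)) * t) * t) ^ 2 := by
    rw [← h1]
    linear_combination (u * F * d) ^ 2 * hu
  have e3 : Q * d ^ 2 * (u * (u * F - f)) =
      t * (d * ((1 - A * (y * (A + 2)) * t) * t) - f * d ^ 2) := by
    rw [← h1]
    linear_combination (d ^ 2 * u * F - d ^ 2 * f) * hu
  have e4 : Q * d ^ 2 * (u - 1) = (t - Q) * d ^ 2 := by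
    linear_combination d ^ 2 * hu
  refine mul_left_cancel₀ (mul_ne_zero hQ0 (pow_ne_zero 2 hd0)) ?_
  rw [mul_add, mul_left_comm _ (3 * y), mul_add (_ * _), e1, e2, e3, e4, hQ, hd]
  linear_combination (A ^ 3 * y ^ 3 * t ^ 5 +
      3 * A ^ 3 * y ^ 3 * t ^ 4 + 4 * A ^ 2 * y ^ 3 * t ^ 5 +
    6 * A ^ 2 * y ^ 3 * t ^ 4 + 4 * A * y ^ 3 * t ^ 5 - A ^ 2 * y ^ 2 * t ^ 4 +
    2 * A ^ 2 * y ^ 2 * t ^ 3 - 3 * A * y ^ 2 * t ^ 4 - 8 * A * y ^ 2 * t ^ 3 - 2 * y ^ 2 * t ^ 4 -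
    A * y * t ^ 2 + y * t ^ 3 + 2 * y * t ^ 2) * hA + y * t * (1 - 3 * y * A * t) ^ 2 * hf

end algebra

theorem Nat.four_mul_catalan (n : ℕ) :
    (n + 2) * (4 * catalan n) = 6 * catalan n + (n + 2) * catalan (n + 1) := by
  have h1 := succ_mul_catalan_eq_centralBinom n
  have h2 := succ_mul_catalan_eq_centralBinom (n + 1)
  have h3 := Nat.succ_mul_centralBinom_succ n
  rw [← h2, ← h1] at h3
  have h4 : (n + 2) * catalan (n + 1) = 2 * (2 * n + 1) * catalan n := by
    refine Nat.eq_of_mul_eq_mul_left (Nat.succ_pos n) ?_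
    linarith
  linarith

namespace PowerSeries

/-- A root of `A = 1 + 3 z A²`. -/
theorem exists_quadratic_root (R : Type*) [CommRing R] :
    ∃ A : R⟦X⟧, A = 1 + 3 * X * A ^ 2 ∧ ∀ n, coeff n A = 3 ^ n * (catalan n : R) := by
  refine ⟨rescale 3 (map (Nat.castRingHom R) catalanSeries), ?_, fun n => by simp⟩
  have := congrArg (fun f => rescale (3 : R) (map (Nat.castRingHom R) f))
    catalanSeries_sq_mul_X_add_one
  simp only [map_add, map_mul, map_pow, map_X, map_one, rescale_X] at this
  conv_lhs => rw [← this]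
  have h3 : C (3 : R) = 3 := map_ofNat _ 3
  rw [h3]
  ring

/-- A power series root of `t = u (1 + P t + Q t²)`. -/
theorem exists_quadratic_fixed_point {R : Type*} [CommRing R] (u : R) {P Q : R⟦X⟧}
    (hP : constantCoeff P = 0) (hQ : constantCoeff Q = 0) :
    ∃ t : R⟦X⟧, C u * (1 + P * t + Q * t ^ 2) = t := by
  set v := invOfUnit (1 - C u * P) 1
  have hv : (1 - C u * P) * v = 1 := mul_invOfUnit _ _ (by simp [hP])
  set w : R⟦X⟧ := C u ^ 2 * Q * v ^ 2 with hw
  have hs : HasSubst w := HasSubst.of_constantCoeff_zero' (by simp [hw, hQ])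
  have hc := congrArg (fun f => subst w (map (Nat.castRingHom R) f))
    catalanSeries_sq_mul_X_add_one
  have hmap : subst w (map (Nat.castRingHom R) (catalanSeries ^ 2 * X + 1)) =
      subst w (map (Nat.castRingHom R) catalanSeries) ^ 2 * w + 1 := by
    rw [← coe_substAlgHom hs]
    simp only [map_add, map_mul, map_pow, map_X, map_one]
    rw [coe_substAlgHom hs, subst_X hs]
  rw [hmap] at hc
  set c := subst w (map (Nat.castRingHom R) catalanSeries)
  refine ⟨C u * v * c, ?_⟩
  rw [hw] at hc
  linear_combination C u * hc - C u * c * hv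

end PowerSeries

theorem exists_isTutteSequence : ∃ F : ℕ → ℚ[X], IsTutteSequence F ∧
    ∀ n : ℕ, (n + 2 : ℚ) * (F n).eval 1 = 2 * 3 ^ n * catalan n := by
  obtain ⟨A, hA, hAc⟩ := PowerSeries.exists_quadratic_root ℚ[X]
  set c : PowerSeries ℚ[X] := PowerSeries.C (C (1 / 3)) with hc
  have hc3 : 3 * c = 1 := by
    rw [hc, ← map_ofNat (PowerSeries.C (R := ℚ[X])) 3, ← map_ofNat (C (R := ℚ)) 3,
      ← map_mul, ← map_mul]
    norm_num
  set y : PowerSeries ℚ[X] := c * PowerSeries.X with hy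
  have hy3 : 3 * y = PowerSeries.X := by rw [hy, ← mul_assoc, hc3, one_mul]
  have hy0 : PowerSeries.constantCoeff y = 0 := by simp [hy]
  obtain ⟨t, ht⟩ := PowerSeries.exists_quadratic_fixed_point (X : ℚ[X]) (P := 3 * y * A)
    (Q := y * (A + 2)) (by simp [hy0]) (by simp [hy0])
  set d := 1 - 3 * y * A * t with hd
  set Q := 1 + 3 * y * A * t + y * (A + 2) * t ^ 2 with hQ
  have hd1 : PowerSeries.constantCoeff d = 1 := by simp [hd, hy0]
  have hQ1 : PowerSeries.constantCoeff Q = 1 := by simp [hQ, hy0]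
  have hdi : d * PowerSeries.invOfUnit d 1 = 1 := PowerSeries.mul_invOfUnit _ _ (by simp [hd1])
  set G := (1 - A * (y * (A + 2)) * t) * Q * PowerSeries.invOfUnit d 1 with hG
  set f := c * (A * (4 - A)) with hf
  have hT := tutte_identity (A := A) (y := y) (t := t) (u := PowerSeries.C X) (d := d)
    (Q := Q) (F := G) (f := f) (by linear_combination hA - 3 * A ^ 2 * hy3)
    hQ ht hd (by rw [hG]; linear_combination (1 - A * (y * (A + 2)) * t) * Q * hdi)
    (by rw [hf]; linear_combination A * (4 - A) * hc3)
    (fun h => by simp [h] at hQ1) (fun h => by simp [h] at hd1)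
  rw [hy3] at hT
  have hC1 : (PowerSeries.C X - 1 : PowerSeries ℚ[X]) = PowerSeries.C (X - 1) := by
    simp
  have hfc : ∀ n : ℕ, (n + 2 : ℚ[X]) * PowerSeries.coeff n f = C (2 * 3 ^ n * (catalan n : ℚ)) := by
    intro n
    have h1 : 9 * PowerSeries.X * f = 12 * PowerSeries.X * A - A + 1 := by
      rw [hf]
      linear_combination 3 * PowerSeries.X * A * (4 - A) * hc3 + hA
    have h2 := congrArg (PowerSeries.coeff (n + 1)) h1
    have h9 : (9 : PowerSeries ℚ[X]) = PowerSeries.C 9 := (map_ofNat _ 9).symm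
    have h12 : (12 : PowerSeries ℚ[X]) = PowerSeries.C 12 := (map_ofNat _ 12).symm
    rw [h9, h12, mul_assoc, mul_assoc, map_add, map_sub, PowerSeries.coeff_C_mul,
      PowerSeries.coeff_C_mul, PowerSeries.coeff_succ_X_mul, PowerSeries.coeff_succ_X_mul,
      hAc, hAc, PowerSeries.coeff_one, if_neg (Nat.succ_ne_zero n), add_zero] at h2
    have h3 := congrArg (Nat.cast (R := ℚ[X])) (Nat.four_mul_catalan n)
    push_cast at h3
    have h4 : (9 : ℚ[X]) ≠ 0 := by norm_num
    refine mul_left_cancel₀ h4 ?_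
    simp only [map_mul, map_pow, map_natCast, map_ofNat]
    linear_combination (n + 2 : ℚ[X]) * h2 + 3 * 3 ^ n * h3
  have hrec : ∀ n, (X - 1) * PowerSeries.coeff (n + 1) G =
    (X - 1) * X ^ 2 *
      ∑ k ∈ Finset.range (n + 1), PowerSeries.coeff k G * PowerSeries.coeff (n - k) G +
      X * (X * PowerSeries.coeff n G - PowerSeries.coeff n f) := by
    intro n
    have h2 := congrArg (PowerSeries.coeff (n + 1)) hT
    rw [hC1, ← map_pow, mul_assoc (PowerSeries.C _) (PowerSeries.C _), map_add,
      PowerSeries.coeff_succ_X_mul, map_add, PowerSeries.coeff_C_mul, PowerSeries.coeff_C_mul,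
      PowerSeries.coeff_C_mul, PowerSeries.coeff_C_mul, map_sub (PowerSeries.coeff n),
      PowerSeries.coeff_C_mul,
      PowerSeries.coeff_C, if_neg (Nat.succ_ne_zero n), pow_two G, PowerSeries.coeff_mul n G G,
      Finset.Nat.sum_antidiagonal_eq_sum_range_succ fun i j =>
        PowerSeries.coeff i G * PowerSeries.coeff j G] at h2
    rw [h2]
    ring
  have hev : ∀ n, PowerSeries.coeff n f = C ((PowerSeries.coeff n G).eval 1) := by
    intro n
    have h1 : PowerSeries.coeff n f = C (2 * 3 ^ n * (catalan n : ℚ) / (n + 2)) := by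
      have h0 : (n + 2 : ℚ[X]) ≠ 0 := by exact_mod_cast Nat.succ_ne_zero (n + 1)
      have h0' : (n + 2 : ℚ) ≠ 0 := by positivity
      refine mul_left_cancel₀ h0 ?_
      rw [hfc, ← C_eq_natCast, ← map_ofNat C 2, ← map_add, ← map_mul, mul_div_cancel₀ _ h0']
    have h2 := congrArg (eval 1) (hrec n)
    simp only [eval_mul, eval_add, eval_sub, eval_X, eval_one, sub_self, zero_mul, one_mul,
      zero_add] at h2
    rw [h1, sub_eq_zero.1 h2.symm, h1, eval_C]
  refine ⟨fun n => PowerSeries.coeff n G, ⟨?_, fun n => ?_⟩, fun n => ?_⟩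
  · have h1 := congrArg (PowerSeries.coeff 0) hT
    rw [hC1, map_add, PowerSeries.coeff_C_mul, PowerSeries.coeff_zero_X_mul, add_zero,
      PowerSeries.coeff_C, if_pos rfl] at h1
    exact (mul_eq_left₀ (by simpa using X_sub_C_ne_zero (1 : ℚ))).1 h1
  · rw [hrec, hev]
  · have := hfc n
    rw [hev] at this
    apply Polynomial.C_injective
    rw [← this]
    simp only [map_mul, map_add, map_natCast, map_ofNat]

namespace Equiv.Perm

variable {D : Type*}

theorem orbits_eq_top_iff (σ α : Perm D) :
    orbits σ α = ⊤ ↔ ∀ x y, ∃ g ∈ Subgroup.closure ({σ, α} : Set (Perm D)), g x = y := by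
  set H := Subgroup.closure ({σ, α} : Set (Perm D)) with hH
  rw [Setoid.eq_top_iff_rel]
  constructor
  · intro h x y
    have hle : orbits σ α ≤ MulAction.orbitRel H D := orbits_le_iff.2
      ⟨fun z => (MulAction.orbitRel H D).symm'
          ⟨⟨σ, Subgroup.subset_closure (Set.mem_insert _ _)⟩, rfl⟩,
        fun z => (MulAction.orbitRel H D).symm'
          ⟨⟨α, Subgroup.subset_closure (Set.mem_insert_of_mem _ rfl)⟩, rfl⟩⟩
    obtain ⟨g, hg⟩ := hle (h y x)
    exact ⟨g, g.2, hg⟩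
  · intro h x y
    obtain ⟨g, hg, rfl⟩ := h x y
    have key : ∀ z, orbits σ α z (g z) := by
      induction hg using Subgroup.closure_induction with
      | mem g hg =>
        rcases hg with rfl | rfl
        · exact orbits_rel_left _ _
        · exact orbits_rel_right _ _
      | one => exact fun z => (orbits σ α).refl' z
      | mul g k _ _ hg hk => exact fun z => (orbits σ α).trans' (hk z) (hg (k z))
      | inv g _ hg => exact fun z => (orbits σ α).symm' (by simpa using hg (g⁻¹ z))
    exact key x

theorem two_mul_numCycles_of_isInvolutionFixing_empty [Fintype D] {α : Perm D}
    (h : IsInvolutionFixing α ∅) : 2 * α.numCycles = Fintype.card D := by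
  classical
  have hfix : (Finset.univ.filter fun x => α x = x) = ∅ := by
    ext x
    simp [h.2]
  have hsupp : α.support = Finset.univ := by
    ext x
    simp [h.2]
  have hs := α.sum_cycleType
  rw [cycleType_of_pow_prime_eq_one (p := 2) ((pow_two α).trans h.1), Multiset.sum_replicate,
    hsupp, Finset.card_univ, smul_eq_mul] at hs
  rw [numCycles_eq, hfix, Finset.card_empty, add_zero, mul_comm, hs]

theorem eval_one_rootSum [Fintype D] [DecidableEq D] (a : D) :
    (rootSum D a).eval 1 =
      Nat.card {p : Perm D × Perm D // IsInvolutionFixing p.2 ∅ ∧ IsPlanarPair p.1 p.2} := by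
  classical
  rw [Nat.card_eq_fintype_card, Fintype.card_subtype, ← Finset.sum_boole, Fintype.sum_prod_type,
    rootSum, eval_finsetSum]
  refine Finset.sum_congr rfl fun σ _ => ?_
  rw [eval_finsetSum]
  refine Finset.sum_congr rfl fun α _ => ?_
  by_cases h : IsInvolutionFixing α ∅ ∧ IsPlanarPair σ α
  · rw [propIndicator_of h, if_pos h]
    simp
  · rw [propIndicator_of_not h, if_neg h]
    simp

end Equiv.Perm

end

/--
**Tutte's enumeration of rooted planar maps** in the permutation (rotation-system) encoding:
for `n ≥ 1`, let `N_n` be the number of pairs `(σ, α)` of permutations of a `2n`-element set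
such that `α` is an involution without fixed points, the subgroup `⟨σ, α⟩` acts transitively,
and `ℓ(σ) + ℓ(σ∘α) = n + 2` (planarity).  Then
`(n + 2) · N_n = (2n − 1)! · 2 · 3ⁿ · Cat_n`,
equivalently the number `m_n = N_n/(2n−1)!` of rooted planar maps with `n` edges is
`(2·3ⁿ/(n+2)) · Cat_n`.
-/
theorem stmt_0 (n : ℕ) (hn : 1 ≤ n) :
    (n + 2) * Nat.card {p : Equiv.Perm (Fin (2 * n)) × Equiv.Perm (Fin (2 * n)) //
        p.2 * p.2 = 1 ∧ (∀ x, p.2 x ≠ x) ∧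
        (∀ x y : Fin (2 * n),
          ∃ g ∈ Subgroup.closure ({p.1, p.2} : Set (Equiv.Perm (Fin (2 * n)))), g x = y) ∧
        cycleCount p.1 + cycleCount (p.1 * p.2) = n + 2} =
      Nat.factorial (2 * n - 1) * 2 * 3 ^ n * catalan n := by
  have hiff : ∀ p : Equiv.Perm (Fin (2 * n)) × Equiv.Perm (Fin (2 * n)),
      (p.2 * p.2 = 1 ∧ (∀ x, p.2 x ≠ x) ∧
        (∀ x y : Fin (2 * n),
          ∃ g ∈ Subgroup.closure ({p.1, p.2} : Set (Equiv.Perm (Fin (2 * n)))), g x = y) ∧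
        cycleCount p.1 + cycleCount (p.1 * p.2) = n + 2) ↔
      Equiv.Perm.IsInvolutionFixing p.2 ∅ ∧ Equiv.Perm.IsPlanarPair p.1 p.2 := by
    rintro ⟨σ, α⟩
    have hfix : α * α = 1 ∧ (∀ x, α x ≠ x) ↔ Equiv.Perm.IsInvolutionFixing α ∅ := by
      simp [Equiv.Perm.IsInvolutionFixing]
    simp only
    rw [← and_assoc, hfix, ← Equiv.Perm.orbits_eq_top_iff]
    refine and_congr_right fun h => and_congr_right fun _ => ?_
    have h2 := Equiv.Perm.two_mul_numCycles_of_isInvolutionFixing_empty h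
    rw [Fintype.card_fin] at h2
    rw [Nat.card_eq_fintype_card, Fintype.card_fin, cycleCount, cycleCount,
      ← Equiv.Perm.numCycles_eq, ← Equiv.Perm.numCycles_eq]
    omega
  rw [Nat.card_congr (Equiv.subtypeEquivRight hiff)]
  obtain ⟨F, hF, hF1⟩ := exists_isTutteSequence
  obtain ⟨m, rfl⟩ := Nat.exists_eq_add_of_le' hn
  have hm := hF1 (m + 1)
  have hroot := Equiv.Perm.eval_one_rootSum (0 : Fin (2 * (m + 1)))
  rw [Equiv.Perm.rootSum_eq hF (n := m) (by simp [mul_add]), Polynomial.eval_mul,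
    Polynomial.eval_natCast] at hroot
  have hsub : 2 * (m + 1) - 1 = 2 * m + 1 := by omega
  rw [hsub, ← Nat.cast_inj (R := ℚ)]
  push_cast at hm ⊢
  rw [← hroot]
  linear_combination ((2 * m + 1).factorial : ℚ) * hm
end

section
/- Plücker relations for maximal minors: let R be a commutative ring and k ≥ 1 an integer. For vectors w₁, …, w_{k−1} and u₀, u₁, …, u_k in R^k, write det(v₁, …, v_k) for the determinant of the k×k matrix whose columns are v₁, …, v_k. Then Σ_{p=0}^{k} (−1)^p · det(w₁, …, w_{k−1}, u_p) · det(u₀, …, û_p, …, u_k) = 0, where û_p means that the column u_p is omitted. Equivalently, for a k×n matrix A and any column-index sequences (i₁, …, i_{k−1}) and (j₀, …, j_k), the maximal minors Δ of A satisfy Σ_{p=0}^{k} (−1)^p Δ_{i₁,…,i_{k−1},j_p} · Δ_{j₀,…,ĵ_p,…,j_k} = 0. -/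
/-- The signed sum of the maximal minors of a `k × (k + 1)` matrix, weighted by the entries of one
of its rows, vanishes: it expands a determinant with a repeated row. -/
theorem Matrix.sum_row_mul_det_succAbove_eq_zero {R : Type*} [CommRing R] {k : ℕ}
    (u : Fin (k + 1) → Fin k → R) (i : Fin k) :
    ∑ p : Fin (k + 1), (-1 : R) ^ (p : ℕ) * u p i
      * (Matrix.of fun r c : Fin k => u (p.succAbove c) r).det = 0 := by
  let A : Matrix (Fin (k + 1)) (Fin (k + 1)) R :=
    Matrix.of (Fin.cons (fun p => u p i) fun r p => u p r)
  have hA : A.det = 0 :=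
    Matrix.det_zero_of_row_eq (Fin.succ_ne_zero i).symm (by ext p; simp [A])
  rw [Matrix.det_succ_row_zero] at hA
  exact hA

/--
**Plücker relations for maximal minors.**  Let `R` be a commutative ring and `k = m + 1 ≥ 1`.
For vectors `w₁, …, w_{k−1}` and `u₀, u₁, …, u_k` in `R^k`, writing `det(v₁, …, v_k)` for the
determinant of the `k × k` matrix with columns `v₁, …, v_k`, one has
`Σ_{p=0}^{k} (−1)^p det(w₁, …, w_{k−1}, u_p) · det(u₀, …, û_p, …, u_k) = 0`,
where `û_p` means that the column `u_p` is omitted (the omission being realized by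
`Fin.succAbove p`).
-/
theorem stmt_2 {R : Type*} [CommRing R] (m : ℕ)
    (w : Fin m → Fin (m + 1) → R) (u : Fin (m + 2) → Fin (m + 1) → R) :
    ∑ p : Fin (m + 2), (-1 : R) ^ (p : ℕ)
        * (Matrix.of fun r c : Fin (m + 1) =>
            (Fin.snoc w (u p) : Fin (m + 1) → Fin (m + 1) → R) c r).det
        * (Matrix.of fun r c : Fin (m + 1) => u (p.succAbove c) r).det = 0 := by
  have hdet (p : Fin (m + 2)) :
      (Matrix.of fun r c : Fin (m + 1) =>
        (Fin.snoc w (u p) : Fin (m + 1) → Fin (m + 1) → R) c r).det =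
      ∑ i : Fin (m + 1), (-1 : R) ^ (i + m : ℕ) * u p i
        * (Matrix.of fun r c : Fin m => w c (i.succAbove r)).det := by
    rw [Matrix.det_succ_column _ (Fin.last m)]
    refine Finset.sum_congr rfl fun i _ => ?_
    congr 2
    · simp
    · ext r c
      simp
  simp_rw [hdet, Finset.mul_sum, Finset.sum_mul]
  rw [Finset.sum_comm]
  refine Finset.sum_eq_zero fun i _ => ?_
  rw [← mul_zero ((-1 : R) ^ (i + m : ℕ) * (Matrix.of fun r c : Fin m => w c (i.succAbove r)).det),
    ← Matrix.sum_row_mul_det_succAbove_eq_zero u i, Finset.mul_sum]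
  refine Finset.sum_congr rfl fun p _ => ?_
  ring
end

section
/- Let t, μ, M be real numbers with μ ≥ 0 and M > 0, and assume that M satisfies the melonic fixed-point equation M = 1 + t·M⁴ + t·μ·M². Then t·M⁴ + (1/3)·t·μ·M² = 1/3 if and only if 3M³ − 4M² + μM − 2μ = 0. -/
/--
In the quartic `O(N)³` tensor model, let `M` be a positive solution of the melonic fixed-point
equation `M = 1 + t M⁴ + t μ M²` with `μ ≥ 0`.  Then the dipole generating series
`U = t M⁴ + (1/3) t μ M²` equals `1/3` if and only if `3M³ − 4M² + μM − 2μ = 0`,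
i.e. the locus `U = 1/3` is the critical locus of the melonic generating series.
-/
theorem stmt_3 (t μ M : ℝ) (hμ : 0 ≤ μ) (hM : 0 < M)
    (hfix : M = 1 + t * M ^ 4 + t * μ * M ^ 2) :
    t * M ^ 4 + (1 / 3) * t * μ * M ^ 2 = 1 / 3 ↔
      3 * M ^ 3 - 4 * M ^ 2 + μ * M - 2 * μ = 0 := by
  have hpos : 0 < M ^ 2 + μ := by positivity
  have key : 3 * M ^ 3 - 4 * M ^ 2 + μ * M - 2 * μ =
      (M ^ 2 + μ) * (3 * (t * M ^ 4 + (1 / 3) * t * μ * M ^ 2) - 1) := by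
    linear_combination (3 * M ^ 2 + μ) * hfix
  rw [key, mul_eq_zero, or_iff_right hpos.ne']
  constructor <;> intro h <;> linarith
end

section
/- For every real number μ ≥ 0, the cubic polynomial 3x³ − 4x² + μx − 2μ has exactly one positive real root; that is, there exists a unique real x > 0 such that 3x³ − 4x² + μx − 2μ = 0 (equivalently, such that −3x³ + 4x² − μx + 2μ = 0). -/
/-- For `μ ≥ 0`, a positive root of `3x³ − 4x² + μx − 2μ` is at least `4/3`. -/
theorem four_thirds_le_of_cubic_eq_zero {μ x : ℝ} (hμ : 0 ≤ μ) (hx : 0 < x)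
    (h : 3 * x ^ 3 - 4 * x ^ 2 + μ * x - 2 * μ = 0) : 4 / 3 ≤ x := by
  by_contra! hlt
  have h₁ : 0 < x ^ 2 * (4 - 3 * x) := mul_pos (by positivity) (by linarith)
  have h₂ : 0 ≤ μ * (2 - x) := mul_nonneg hμ (by linarith)
  linarith

/--
For every real `μ ≥ 0`, the cubic polynomial `3x³ − 4x² + μx − 2μ` has exactly one positive
real root: there is a unique `x > 0` with `3x³ − 4x² + μx − 2μ = 0` (equivalently, with
`−3x³ + 4x² − μx + 2μ = 0`).
-/
theorem stmt_4 (μ : ℝ) (hμ : 0 ≤ μ) :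
    ∃! x : ℝ, 0 < x ∧ 3 * x ^ 3 - 4 * x ^ 2 + μ * x - 2 * μ = 0 := by
  obtain ⟨x, ⟨hx, -⟩, h⟩ : (0 : ℝ) ∈
      (fun x : ℝ => 3 * x ^ 3 - 4 * x ^ 2 + μ * x - 2 * μ) '' Set.Icc (4 / 3) 2 :=
    intermediate_value_Icc (by norm_num) (by fun_prop)
      ⟨by norm_num; linarith, by norm_num; linarith⟩
  have hx₀ : 0 < x := by linarith
  refine ⟨x, ⟨hx₀, h⟩, fun y ⟨hy₀, hy⟩ => ?_⟩
  have hy' := four_thirds_le_of_cubic_eq_zero hμ hy₀ hy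
  have hfactor : (y - x) * (x * (3 * x - 4) + y * (3 * y - 4) + 3 * (x * y) + μ) = 0 := by
    linear_combination hy - h
  have hpos : 0 < x * (3 * x - 4) + y * (3 * y - 4) + 3 * (x * y) + μ := by
    have h₁ : 0 ≤ x * (3 * x - 4) := mul_nonneg hx₀.le (by linarith)
    have h₂ : 0 ≤ y * (3 * y - 4) := mul_nonneg hy₀.le (by linarith)
    have h₃ : 0 < x * y := mul_pos hx₀ hy₀
    linarith
  exact sub_eq_zero.mp ((mul_eq_zero.mp hfactor).resolve_right hpos.ne')
end

section
/- Let R = ℚ[p₁, p₂, p₃, …] and let r ≥ 1 be an integer. Let Z ∈ R[[t]] be a formal power series in t with coefficients in R such that: (i) for every n ≥ 0 the coefficient [t^n]Z is a homogeneous polynomial of total degree n in the variables p_i; (ii) there exist ℚ-linear operators M⁽¹⁾, …, M⁽ʳ⁾ on R, independent of t, such that ∂Z/∂t = Σ_{m=1}^{r} t^{m−1} · M⁽ᵐ⁾ Z; (iii) there exist ℚ-linear operators M⁽ᵐ⁾_i on R (1 ≤ m ≤ r, i ≥ 1) with M⁽ᵐ⁾ = Σ_{i≥1} (multiplication by p_i)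 ∘ M⁽ᵐ⁾_i (a locally finite sum), such that, defining for each i ≥ 1 the operator L_i = i·∂/∂p_i − Σ_{m=1}^{r} t^m · M⁽ᵐ⁾_i (a polynomial in t with operator coefficients, acting on R[[t]]), the following hold: (a) for all n and i, [t^n](L_i Z) is a homogeneous polynomial of degree n − i, and [t^n](L_i Z) = 0 when n < i; (b) there exist operators D_{ij}^k (i, j, k ≥ 1), polynomial in t, with all sums over k locally finite, such that [L_i, L_j] = t · Σ_{k≥1} D_{ij}^k ∘ L_k. Then L_i Z = 0 for all i ≥ 1. -/
noncomputable section

/-- The polynomial ring `ℚ[p₁, p₂, …]`, with one variable `p_i` for each positive integer. -/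
abbrev Rp : Type := MvPolynomial ℕ+ ℚ

/-- The partial derivative `∂/∂p_i` as a `ℚ`-linear endomorphism (junk value `0` for `i = 0`). -/
def pderivN (i : ℕ) : Module.End ℚ Rp :=
  if h : 0 < i then (MvPolynomial.pderiv (⟨i, h⟩ : ℕ+)).toLinearMap else 0

/-- Multiplication by the variable `p_i` (junk value `0` for `i = 0`). -/
def mulpN (i : ℕ) : Module.End ℚ Rp :=
  if h : 0 < i then LinearMap.mulLeft ℚ (MvPolynomial.X (⟨i, h⟩ : ℕ+)) else 0

/-- The operator `p_i^* = i·∂/∂p_i`. -/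
def pstar (i : ℕ) : Module.End ℚ Rp := (i : ℚ) • pderivN i

/-- A linear operator on `R` acting coefficientwise on formal power series in `t`, the latter
being encoded by their coefficient sequences `ℕ → R` (so `Z n = [tⁿ]Z`). -/
def liftE (φ : Module.End ℚ Rp) : Module.End ℚ (ℕ → Rp) where
  toFun := fun F n => φ (F n)
  map_add' := fun F G => by funext n; simp
  map_smul' := fun c F => by funext n; simp

/-- Multiplication by the variable `t` on formal power series in `t`, i.e. the shift of
coefficient sequences. -/
def tshift : Module.End ℚ (ℕ → Rp) where
  toFun := fun F n => if n = 0 then 0 else F (n - 1)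
  map_add' := fun F G => by funext n; by_cases h : n = 0 <;> simp [h]
  map_smul' := fun c F => by funext n; by_cases h : n = 0 <;> simp [h]

/-- The operator `L_i = i·∂/∂p_i − Σ_{m=1}^{r} t^m · M_i⁽ᵐ⁾`, a polynomial in `t` with
operator coefficients, acting on power series in `t`. -/
def Lop (r : ℕ) (Mi : ℕ → ℕ → Module.End ℚ Rp) (i : ℕ) : Module.End ℚ (ℕ → Rp) :=
  liftE (pstar i) - ∑ m ∈ Finset.Icc 1 r, tshift ^ m * liftE (Mi m i)

/-- The operator with polynomial dependence on `t` whose coefficient of `t^a` is `Dc a`. -/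
def Dop (Dc : ℕ → Module.End ℚ Rp) : Module.End ℚ (ℕ → Rp) :=
  ∑ᶠ a : ℕ, tshift ^ a * liftE (Dc a)

/-- The subspace `tⁿ R[[t]]` of coefficient sequences vanishing below index `n`. -/
def orderGE (n : ℕ) : Submodule ℚ (ℕ → Rp) where
  carrier := {F | ∀ m < n, F m = 0}
  add_mem' := fun hF hG m hm => by simp [hF m hm, hG m hm]
  zero_mem' := fun _ _ => rfl
  smul_mem' := fun c F hF m hm => by simp [hF m hm]

lemma liftE_apply (φ : Module.End ℚ Rp) (F : ℕ → Rp) (n : ℕ) : liftE φ F n = φ (F n) := rfl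

lemma tshift_pow_apply (m : ℕ) (F : ℕ → Rp) (n : ℕ) :
    (tshift ^ m) F n = if m ≤ n then F (n - m) else 0 := by
  induction m generalizing n with
  | zero => simp
  | succ m ih =>
    rw [pow_succ', Module.End.mul_apply]
    change (if n = 0 then 0 else (tshift ^ m) F (n - 1)) = _
    rw [ih]
    rcases n with _ | n
    · simp
    · simp

lemma tshift_pow_liftE_mem (a n : ℕ) (φ : Module.End ℚ Rp) {F : ℕ → Rp} (hF : F ∈ orderGE n) :
    (tshift ^ a * liftE φ) F ∈ orderGE n := by
  intro m hm
  rw [Module.End.mul_apply, tshift_pow_apply, liftE_apply]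
  split_ifs
  · rw [hF _ (by omega), map_zero]
  · rfl

lemma Lop_apply (r : ℕ) (Mi : ℕ → ℕ → Module.End ℚ Rp) (i : ℕ) (F : ℕ → Rp) (n : ℕ) :
    Lop r Mi i F n = pstar i (F n) -
      ∑ m ∈ Finset.Icc 1 r, if m ≤ n then Mi m i (F (n - m)) else 0 := by
  simp [Lop, liftE_apply, tshift_pow_apply]

lemma Lop_mem (r : ℕ) (Mi : ℕ → ℕ → Module.End ℚ Rp) (i n : ℕ) {F : ℕ → Rp}
    (hF : F ∈ orderGE n) : Lop r Mi i F ∈ orderGE n := by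
  intro m hm
  rw [Lop_apply, hF m hm, map_zero, zero_sub, neg_eq_zero]
  refine Finset.sum_eq_zero fun a _ => ?_
  split_ifs
  · rw [hF _ (by omega), map_zero]
  · rfl

lemma Lop_apply_of_mem (r : ℕ) (Mi : ℕ → ℕ → Module.End ℚ Rp) (i n : ℕ) {F : ℕ → Rp}
    (hF : F ∈ orderGE n) : Lop r Mi i F n = pstar i (F n) := by
  rw [Lop_apply, sub_eq_self]
  refine Finset.sum_eq_zero fun a ha => ?_
  rw [Finset.mem_Icc] at ha
  split_ifs
  · rw [hF _ (by omega), map_zero]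
  · rfl

lemma Dop_mem (Dc : ℕ → Module.End ℚ Rp) (n : ℕ) {F : ℕ → Rp} (hF : F ∈ orderGE n) :
    Dop Dc F ∈ orderGE n := by
  refine finsum_induction (fun T : Module.End ℚ (ℕ → Rp) => T F ∈ orderGE n) ?_ ?_ ?_
  · exact Submodule.zero_mem _
  · exact fun S T hS hT => Submodule.add_mem _ hS hT
  · exact fun a => tshift_pow_liftE_mem a n _ hF

lemma tshift_apply_of_mem {n : ℕ} {F : ℕ → Rp} (hF : F ∈ orderGE n) : tshift F n = 0 := by
  change (if n = 0 then 0 else F (n - 1)) = 0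
  split_ifs
  · rfl
  · exact hF _ (by omega)

lemma mulpN_coe (i : ℕ+) (f : Rp) : mulpN i f = MvPolynomial.X i * f := by
  rw [mulpN, dif_pos i.pos, LinearMap.mulLeft_apply]
  rfl

lemma pstar_coe (i : ℕ+) (f : Rp) : pstar i f = (i : ℚ) • MvPolynomial.pderiv i f := by
  have h : pderivN i = (MvPolynomial.pderiv i).toLinearMap := dif_pos i.pos
  rw [pstar, h]
  rfl

lemma isHomogeneous_mulpN (i : ℕ+) {f : Rp} {n : ℕ} (hf : f.IsHomogeneous n) :
    (mulpN i f).IsHomogeneous (n + 1) := by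
  rw [mulpN_coe, add_comm]
  exact (MvPolynomial.isHomogeneous_X _ _).mul hf

lemma coeff_X_mul_pderiv (i : ℕ+) (f : Rp) (s : ℕ+ →₀ ℕ) :
    (MvPolynomial.X i * MvPolynomial.pderiv i f).coeff s = (s i : ℚ) * f.coeff s := by
  classical
  induction f using MvPolynomial.induction_on' with
  | monomial u a =>
    rw [MvPolynomial.pderiv_monomial, MvPolynomial.X, MvPolynomial.monomial_mul,
      MvPolynomial.coeff_monomial, MvPolynomial.coeff_monomial]
    by_cases h : u i = 0
    · by_cases hus : u = s
      · subst hus; simp [h]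
      · simp [h, hus]
    · have : Finsupp.single i 1 + (u - Finsupp.single i 1) = u := by
        rw [add_comm]
        exact tsub_add_cancel_of_le (by simpa using Nat.one_le_iff_ne_zero.mpr h)
      rw [this]
      split_ifs with hus
      · subst hus; ring
      · simp
  | add p q hp hq => simp [mul_add, hp, hq]

lemma isHomogeneous_mulpN_pstar (i : ℕ+) {f : Rp} {n : ℕ} (hf : f.IsHomogeneous n) :
    (mulpN i (pstar i f)).IsHomogeneous n := by
  intro s hs
  rw [mulpN_coe, pstar_coe, mul_smul_comm, MvPolynomial.coeff_smul, coeff_X_mul_pderiv] at hs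
  exact hf fun h => hs (by simp [h])

lemma coeff_eq_zero_of_pstar_eq_zero {i : ℕ+} {f : Rp} (h : pstar i f = 0) {s : ℕ+ →₀ ℕ}
    (hs : s i ≠ 0) : f.coeff s = 0 := by
  have h0 : MvPolynomial.pderiv i f = 0 := by
    rw [pstar_coe] at h
    exact (smul_eq_zero.mp h).resolve_left (by exact_mod_cast i.ne_zero)
  have := coeff_X_mul_pderiv i f s
  rw [h0, mul_zero, MvPolynomial.coeff_zero] at this
  exact (mul_eq_zero.mp this.symm).resolve_left (by exact_mod_cast hs)

/-- If the `L_i Z` vanish to order `n`, then `p_i^* [tⁿ](L_j Z) = p_j^* [tⁿ](L_i Z)`. -/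
lemma pstar_Lop_comm (r : ℕ) (Z : ℕ → Rp) (Mi : ℕ → ℕ → Module.End ℚ Rp)
    (Dc : ℕ → ℕ → ℕ → ℕ → Module.End ℚ Rp) {i j : ℕ}
    (hcomm : ∀ F : ℕ → Rp, (Function.support F).Finite →
      ⁅Lop r Mi i, Lop r Mi j⁆ F =
        tshift (∑ᶠ k ∈ Set.Ici (1 : ℕ), (Dop (Dc i j k)) ((Lop r Mi k) F)))
    {n : ℕ} (hn : ∀ k, 1 ≤ k → Lop r Mi k Z ∈ orderGE n) (hi : 1 ≤ i) (hj : 1 ≤ j) :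
    pstar i (Lop r Mi j Z n) = pstar j (Lop r Mi i Z n) := by
  set F : ℕ → Rp := fun m => if m ≤ n then Z m else 0 with hF
  have hfin : (Function.support F).Finite := by
    refine (Set.finite_Iic n).subset fun m hm => ?_
    by_contra h
    exact hm (if_neg h)
  have hFZ : F - Z ∈ orderGE (n + 1) := by
    intro m hm
    simp [hF, Nat.lt_succ_iff.mp hm]
  have hL : ∀ k m, m ≤ n → Lop r Mi k F m = Lop r Mi k Z m := by
    intro k m hm
    have := Lop_mem r Mi k _ hFZ m (by omega)
    rwa [map_sub, Pi.sub_apply, sub_eq_zero] at this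
  have hLF : ∀ k, 1 ≤ k → Lop r Mi k F ∈ orderGE n := by
    intro k hk m hm
    rw [hL k m hm.le, hn k hk m hm]
  have h := congrFun (hcomm F hfin) n
  rw [tshift_apply_of_mem, Ring.lie_def, LinearMap.sub_apply, Pi.sub_apply,
    Module.End.mul_apply, Module.End.mul_apply, Lop_apply_of_mem r Mi i n (hLF j hj),
    Lop_apply_of_mem r Mi j n (hLF i hi), hL j n le_rfl, hL i n le_rfl, sub_eq_zero] at h
  · exact h
  · exact finsum_mem_induction (· ∈ orderGE n) (Submodule.zero_mem _)
      (fun _ _ hx hy => Submodule.add_mem _ hx hy) fun k hk => Dop_mem _ _ (hLF k hk)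

/-- The evolution equation in terms of the `L_i`, over any large enough finite set of indices. -/
lemma exists_sum_mulpN_Lop (r : ℕ) (Z : ℕ → Rp) (Mop : ℕ → Module.End ℚ Rp)
    (hevol : ∀ n : ℕ,
      ((n : ℚ) + 1) • Z (n + 1) =
        ∑ m ∈ Finset.Icc 1 r, if m ≤ n + 1 then (Mop m) (Z (n + 1 - m)) else 0)
    (Mi : ℕ → ℕ → Module.End ℚ Rp)
    (hMfin : ∀ m ∈ Finset.Icc 1 r, ∀ f : Rp,
      (Set.Ici 1 ∩ Function.support fun i : ℕ => (mulpN i) ((Mi m i) f)).Finite)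
    (hMdec : ∀ m ∈ Finset.Icc 1 r, ∀ f : Rp,
      (Mop m) f = ∑ᶠ i ∈ Set.Ici (1 : ℕ), (mulpN i) ((Mi m i) f))
    (n : ℕ) :
    ∃ S : Finset ℕ, (∀ i ∈ S, 1 ≤ i) ∧ Finset.Icc 1 (n + 1) ⊆ S ∧
      ∑ i ∈ S, mulpN i (Lop r Mi i Z (n + 1)) =
        ∑ i ∈ S, mulpN i (pstar i (Z (n + 1))) - ((n : ℚ) + 1) • Z (n + 1) := by
  classical
  have hT : ∃ T : ℕ → Finset ℕ, ∀ m ∈ Finset.Icc 1 r,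
      Set.Ici 1 ∩ (Function.support fun i : ℕ => (mulpN i) ((Mi m i) (Z (n + 1 - m))))
        = (T m : Set ℕ) := by
    refine ⟨fun m => if h : m ∈ Finset.Icc 1 r then (hMfin m h (Z (n + 1 - m))).toFinset else ∅,
      fun m hm => ?_⟩
    simp only [dif_pos hm, Set.Finite.coe_toFinset]
  obtain ⟨T, hT⟩ := hT
  have hS1 : ∀ i ∈ Finset.Icc 1 (n + 1) ∪ (Finset.Icc 1 r).biUnion T, 1 ≤ i := by
    intro i hi
    rcases Finset.mem_union.mp hi with hi | hi
    · exact (Finset.mem_Icc.mp hi).1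
    · obtain ⟨m, hm, hi⟩ := Finset.mem_biUnion.mp hi
      have : i ∈ (T m : Set ℕ) := hi
      rw [← hT m hm] at this
      exact this.1
  refine ⟨_, hS1, Finset.subset_union_left, ?_⟩
  set S := Finset.Icc 1 (n + 1) ∪ (Finset.Icc 1 r).biUnion T with hS
  have key : ∀ m ∈ Finset.Icc 1 r, Mop m (Z (n + 1 - m)) =
      ∑ i ∈ S, mulpN i (Mi m i (Z (n + 1 - m))) := by
    intro m hm
    rw [hMdec m hm]
    refine finsum_mem_eq_sum_of_inter_support_eq _ ?_
    ext i
    constructor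
    · intro hi
      refine ⟨?_, hi.2⟩
      have : i ∈ (T m : Set ℕ) := by rw [← hT m hm]; exact hi
      exact Finset.mem_coe.mpr (Finset.mem_union_right _ (Finset.mem_biUnion.mpr ⟨m, hm, this⟩))
    · exact fun hi => ⟨hS1 i hi.1, hi.2⟩
  simp only [Lop_apply, map_sub, Finset.sum_sub_distrib, map_sum]
  rw [hevol n, Finset.sum_comm]
  congr 1
  refine Finset.sum_congr rfl fun m hm => ?_
  split_ifs
  · exact (key m hm).symm
  · simp

/--
**Extraction of constraints from an evolution equation** (`b`-deformed constellations, general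
lemma).  Let `R = ℚ[p₁, p₂, …]`, `r ≥ 1`, and let `Z ∈ R[[t]]` (given by its coefficients
`Z n = [tⁿ]Z`) be such that:
(i) `[tⁿ]Z` is homogeneous of degree `n` in the `p`-variables;
(ii) `∂Z/∂t = Σ_{m=1}^{r} t^{m−1} M⁽ᵐ⁾ Z` for (`t`-independent) operators `M⁽ᵐ⁾` on `R`;
(iii) there are operators `M⁽ᵐ⁾_i` with `M⁽ᵐ⁾ = Σ_{i≥1} p_i ∘ M⁽ᵐ⁾_i` (locally finite) such
that, setting `L_i = i·∂/∂p_i − Σ_{m=1}^{r} t^m M⁽ᵐ⁾_i`: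
(a) `[tⁿ](L_i Z)` is homogeneous of degree `n − i`, and vanishes for `n < i`;
(b) there are operators `D_{ij}^k`, polynomial in `t` (with coefficients `Dc i j k a` of `t^a`,
finitely many nonzero), with locally finite sums over `k`, such that
`[L_i, L_j] = t · Σ_{k≥1} D_{ij}^k ∘ L_k` (the identity in `End(R)[t]` being expressed by
evaluating on every polynomial coefficient sequence `F`).
Then `L_i Z = 0` for all `i ≥ 1`.
-/
theorem stmt_7 (r : ℕ) (hr : 1 ≤ r) (Z : ℕ → Rp)
    (hZhom : ∀ n : ℕ, (Z n).IsHomogeneous n)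
    (Mop : ℕ → Module.End ℚ Rp)
    (hevol : ∀ n : ℕ,
      ((n : ℚ) + 1) • Z (n + 1) =
        ∑ m ∈ Finset.Icc 1 r, if m ≤ n + 1 then (Mop m) (Z (n + 1 - m)) else 0)
    (Mi : ℕ → ℕ → Module.End ℚ Rp)
    (hMfin : ∀ m ∈ Finset.Icc 1 r, ∀ f : Rp,
      (Set.Ici 1 ∩ Function.support fun i : ℕ => (mulpN i) ((Mi m i) f)).Finite)
    (hMdec : ∀ m ∈ Finset.Icc 1 r, ∀ f : Rp,
      (Mop m) f = ∑ᶠ i ∈ Set.Ici (1 : ℕ), (mulpN i) ((Mi m i) f))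
    (hLhom : ∀ i : ℕ, 1 ≤ i → ∀ n : ℕ, ((Lop r Mi i) Z n).IsHomogeneous (n - i))
    (hLvan : ∀ i : ℕ, 1 ≤ i → ∀ n : ℕ, n < i → (Lop r Mi i) Z n = 0)
    (Dc : ℕ → ℕ → ℕ → ℕ → Module.End ℚ Rp)
    (hDpoly : ∀ i j k : ℕ, (Function.support (Dc i j k)).Finite)
    (hcommfin : ∀ i j : ℕ, 1 ≤ i → 1 ≤ j → ∀ F : ℕ → Rp, (Function.support F).Finite →
      (Set.Ici 1 ∩ Function.support fun k : ℕ =>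
        (Dop (Dc i j k)) ((Lop r Mi k) F)).Finite)
    (hcomm : ∀ i j : ℕ, 1 ≤ i → 1 ≤ j → ∀ F : ℕ → Rp, (Function.support F).Finite →
      ⁅Lop r Mi i, Lop r Mi j⁆ F =
        tshift (∑ᶠ k ∈ Set.Ici (1 : ℕ), (Dop (Dc i j k)) ((Lop r Mi k) F))) :
    ∀ i : ℕ, 1 ≤ i → (Lop r Mi i) Z = 0 := by
  suffices H : ∀ n k, 1 ≤ k → Lop r Mi k Z n = 0 from fun i hi => funext fun n => H n i hi
  intro n
  induction n using Nat.strong_induction_on with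
  | _ n ih =>
  rcases n with _ | n
  · exact fun k hk => hLvan k hk 0 hk
  obtain ⟨S, hS1, hSsub, hsum⟩ := exists_sum_mulpN_Lop r Z Mop hevol Mi hMfin hMdec n
  have hA : ∀ j, 2 ≤ j → Lop r Mi j Z (n + 1) = 0 := by
    intro j hj
    by_cases hjn : n + 1 < j
    · exact hLvan j (by omega) _ hjn
    have hrhs : ∑ i ∈ S, mulpN i (pstar i (Z (n + 1))) - ((n : ℚ) + 1) • Z (n + 1) ∈
        MvPolynomial.homogeneousSubmodule ℕ+ ℚ (n + 1) :=
      Submodule.sub_mem _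
        (Submodule.sum_mem _ fun i hi => isHomogeneous_mulpN_pstar ⟨i, hS1 i hi⟩ (hZhom _))
        (Submodule.smul_mem _ _ (hZhom _))
    have hcomp := congrArg (MvPolynomial.homogeneousComponent (n + 1 - j + 1)) hsum
    rw [MvPolynomial.homogeneousComponent_of_mem hrhs, if_neg (by omega), map_sum,
      Finset.sum_eq_single_of_mem j (hSsub (Finset.mem_Icc.mpr (by omega)))] at hcomp
    · lift j to ℕ+ using by omega
      rw [MvPolynomial.homogeneousComponent_of_mem
        (isHomogeneous_mulpN j (hLhom j j.pos (n + 1))), if_pos rfl, mulpN_coe] at hcomp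
      exact (mul_eq_zero.mp hcomp).resolve_left (MvPolynomial.X_ne_zero _)
    · intro i hi hij
      by_cases hin : n + 1 < i
      · rw [hLvan i (hS1 i hi) _ hin, map_zero, map_zero]
      · lift i to ℕ+ using hS1 i hi
        rw [MvPolynomial.homogeneousComponent_of_mem
          (isHomogeneous_mulpN i (hLhom i i.pos (n + 1))), if_neg (by omega)]
  intro k hk
  rcases hk.eq_or_lt with rfl | hk
  swap
  · exact hA k hk
  rw [Finset.sum_eq_single_of_mem 1 (hSsub (Finset.mem_Icc.mpr (by omega)))
    fun i hi hi1 => by rw [hA i (by have := hS1 i hi; omega), map_zero]] at hsum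
  ext s
  rw [MvPolynomial.coeff_zero]
  by_cases hs : ∃ i : ℕ+, 2 ≤ (i : ℕ) ∧ s i ≠ 0
  · obtain ⟨i, hi, hsi⟩ := hs
    refine coeff_eq_zero_of_pstar_eq_zero (i := i) ?_ hsi
    rw [pstar_Lop_comm r Z Mi Dc (hcomm i 1 (by omega) le_rfl)
      (fun k hk m hm => ih m hm k hk) (by omega) le_rfl, hA i hi, map_zero]
  by_contra hne
  have hdeg := hLhom 1 le_rfl (n + 1) hne
  have hs1 : s = Finsupp.single 1 (s 1) := by
    ext i
    by_cases hi : i = 1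
    · subst hi; simp
    · rw [Finsupp.single_eq_of_ne hi]
      by_contra h
      refine hs ⟨i, ?_, h⟩
      have := i.pos
      have : (i : ℕ) ≠ 1 := fun h => hi (PNat.coe_eq_one_iff.mp h)
      omega
  have hsn : s 1 = n := by
    rw [hs1] at hdeg
    simpa [Finsupp.weight_single] using hdeg
  refine hne ?_
  have hc := congrArg (MvPolynomial.coeff (Finsupp.single 1 1 + s)) hsum
  rw [show mulpN 1 = mulpN (1 : ℕ+) from rfl, mulpN_coe, MvPolynomial.coeff_X_mul] at hc
  refine hc.trans ?_
  rw [MvPolynomial.coeff_sub, MvPolynomial.coeff_sum, MvPolynomial.coeff_smul,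
    Finset.sum_eq_single_of_mem 1 (hSsub (Finset.mem_Icc.mpr (by omega)))]
  · rw [show mulpN 1 = mulpN (1 : ℕ+) from rfl, show pstar 1 = pstar (1 : ℕ+) from rfl,
      mulpN_coe, pstar_coe, mul_smul_comm,
      MvPolynomial.coeff_smul, coeff_X_mul_pderiv]
    simp [hsn]
    ring
  · intro i hi hi1
    lift i to ℕ+ using hS1 i hi
    rw [mulpN_coe, pstar_coe, mul_smul_comm, MvPolynomial.coeff_smul, coeff_X_mul_pderiv]
    have h1 : i ≠ 1 := fun h => hi1 (congrArg PNat.val h)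
    have : s i = 0 := by
      by_contra h
      exact hs ⟨i, by have := i.pos; omega, h⟩
    simp [this, Finsupp.single_eq_of_ne h1]
end
end
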